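/- arXiv:2506.20150 — 4 statements merged into one kernel-verified Lean document; each statement's English description precedes it below -/
import Mathlib

section
/- Let s, λ ∈ ℂ with Re s > 0, λ ≠ 0 and |arg λ| < π, and let c ∈ ℝ with −Re s < c < 0. Then the function t ↦ Γ(s+c+it)·Γ(−c−it)·λ^{c+it} is (Bochner) integrable on ℝ, and (1+λ)^{−s} = (1/(2π·Γ(s)))·∫_ℝ Γ(s+c+it)·Γ(−c−it)·λ^{c+it} dt. -/
open MeasureTheory Set Filter Topology

theorem integrableOn_cpow_mul_cexp_neg_mul {w r : ℂ} (hw : 0 < w.re) (hr : 0 < r.re) :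
    IntegrableOn (fun x : ℝ => (x : ℂ) ^ (w - 1) * Complex.exp (-(r * x))) (Ioi 0) := by
  have h := integrableOn_rpow_mul_exp_neg_mul_rpow (s := w.re - 1) (by linarith) one_pos hr
  refine Integrable.mono' h ?_ ?_
  · refine ContinuousOn.aestronglyMeasurable (fun x hx => ?_) measurableSet_Ioi
    have hx' : (x : ℂ) ∈ Complex.slitPlane := Complex.ofReal_mem_slitPlane.2 hx
    refine ContinuousAt.continuousWithinAt (ContinuousAt.mul ?_ (by fun_prop))
    exact (continuousAt_cpow_const hx').comp (Complex.continuous_ofReal.continuousAt (x := x))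
  · filter_upwards [ae_restrict_mem measurableSet_Ioi] with x hx
    rw [norm_mul, Complex.norm_cpow_eq_rpow_re_of_pos hx, Complex.norm_exp]
    simp

theorem differentiableAt_integral_cpow_mul_cexp_neg_mul {w r : ℂ} (hw : 0 < w.re)
    (hr : 0 < r.re) :
    DifferentiableAt ℂ
      (fun r : ℂ => ∫ x : ℝ in Ioi 0, (x : ℂ) ^ (w - 1) * Complex.exp (-(r * x))) r := by
  have hopen : IsOpen {z : ℂ | r.re / 2 < z.re} := isOpen_lt continuous_const Complex.continuous_re
  have hmem : {z : ℂ | r.re / 2 < z.re} ∈ 𝓝 r := hopen.mem_nhds (by simp; linarith)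
  have hw' : 0 < (w + 1).re := by simp; linarith
  refine (hasDerivAt_integral_of_dominated_loc_of_deriv_le (s := {z : ℂ | r.re / 2 < z.re})
    (F' := fun (z : ℂ) (x : ℝ) => (x : ℂ) ^ (w - 1) * (Complex.exp (-(z * x)) * (-x)))
    (bound := fun x : ℝ => x ^ w.re * Real.exp (-(r.re / 2) * x ^ (1 : ℝ)))
    hmem ?_ ?_ ?_ ?_ ?_ ?_).2.differentiableAt
  · filter_upwards [hmem] with z hz
    exact (integrableOn_cpow_mul_cexp_neg_mul hw
      (lt_trans (by linarith) hz)).aestronglyMeasurable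
  · exact integrableOn_cpow_mul_cexp_neg_mul hw hr
  · refine AEStronglyMeasurable.congr (f := fun x : ℝ =>
      ((x : ℂ) ^ (w - 1) * Complex.exp (-(r * x))) * (-x))
      ((integrableOn_cpow_mul_cexp_neg_mul hw hr).aestronglyMeasurable.mul
        (by fun_prop)) (Eventually.of_forall fun x => by simp only [mul_assoc])
  · filter_upwards [ae_restrict_mem measurableSet_Ioi] with x hx z hz
    have hx0 : (0 : ℝ) < x := hx
    have hz' : r.re / 2 < z.re := hz
    rw [norm_mul, norm_mul, Complex.norm_cpow_eq_rpow_re_of_pos hx, Complex.norm_exp, norm_neg,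
      Complex.norm_of_nonneg hx0.le]
    have : x ^ w.re = x ^ (w - 1).re * x := by
      conv_rhs => rw [← Real.rpow_one x, ← Real.rpow_mul hx0.le, ← Real.rpow_add hx0]
      simp
    rw [this, mul_comm (Real.exp _) x, ← mul_assoc]
    gcongr
    simp
    nlinarith
  · exact integrableOn_rpow_mul_exp_neg_mul_rpow (by linarith) one_pos (by linarith)
  · refine Eventually.of_forall fun x z _ => ?_
    have : HasDerivAt (fun z : ℂ => -(z * x)) (-(x : ℂ)) z := by
      simpa using (hasDerivAt_mul_const (x := z) (x : ℂ)).fun_neg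
    exact this.cexp.const_mul _

theorem integral_cpow_mul_cexp_neg_mul {w r : ℂ} (hw : 0 < w.re) (hr : 0 < r.re) :
    ∫ x : ℝ in Ioi 0, (x : ℂ) ^ (w - 1) * Complex.exp (-(r * x)) =
      Complex.exp (-(w * Complex.log r)) * Complex.Gamma w := by
  have hopen : IsOpen {z : ℂ | 0 < z.re} := isOpen_lt continuous_const Complex.continuous_re
  refine AnalyticOnNhd.eqOn_of_preconnected_of_frequently_eq (z₀ := 1) (U := {z : ℂ | 0 < z.re})
    (f := fun r : ℂ => ∫ x : ℝ in Ioi 0, (x : ℂ) ^ (w - 1) * Complex.exp (-(r * x)))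
    (g := fun r => Complex.exp (-(w * Complex.log r)) * Complex.Gamma w)
    (DifferentiableOn.analyticOnNhd (fun z hz =>
      (differentiableAt_integral_cpow_mul_cexp_neg_mul hw hz).differentiableWithinAt) hopen)
    (DifferentiableOn.analyticOnNhd (fun z hz => ?_) hopen)
    (convex_halfSpace_re_gt 0).isPreconnected (by simp) ?_ hr
  · have : z ∈ Complex.slitPlane := Or.inl hz
    have := Complex.differentiableAt_log this
    exact DifferentiableAt.differentiableWithinAt (by fun_prop)
  · have ht : Tendsto (fun x : ℝ => (x : ℂ)) (𝓝[≠] 1) (𝓝[≠] 1) := by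
      refine tendsto_nhdsWithin_iff.2 ⟨?_, ?_⟩
      · exact (Complex.continuous_ofReal.tendsto' 1 1 (by simp)).mono_left nhdsWithin_le_nhds
      · filter_upwards [self_mem_nhdsWithin] with x hx
        simpa using hx
    refine ht.frequently (Eventually.frequently ?_)
    filter_upwards [nhdsWithin_le_nhds (lt_mem_nhds (one_pos : (0 : ℝ) < 1))] with x hx
    rw [Complex.integral_cpow_mul_exp_neg_mul_Ioi hw hx, one_div, ← Complex.ofReal_inv,
      Complex.cpow_def_of_ne_zero (by exact_mod_cast (inv_pos.2 hx).ne'),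
      ← Complex.ofReal_log (inv_pos.2 hx).le, ← Complex.ofReal_log hx.le, Real.log_inv]
    push_cast
    ring_nf

theorem re_exp_pos {B : ℂ} (hB : |B.im| < Real.pi / 2) : 0 < (Complex.exp B).re := by
  rw [Complex.exp_re]
  have := Real.cos_pos_of_mem_Ioo ⟨(abs_lt.1 hB).1, (abs_lt.1 hB).2⟩
  positivity

theorem log_exp_of_abs_im_lt {B : ℂ} (hB : |B.im| < Real.pi / 2) :
    Complex.log (Complex.exp B) = B := by
  have := Real.pi_pos
  rw [abs_lt] at hB
  exact Complex.log_exp (by linarith) (by linarith)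

theorem norm_Gamma_vertical_le_of_abs_lt {σ θ : ℝ} (hσ : 0 < σ) (hθ : |θ| < Real.pi / 2) :
    ∃ C, ∀ t : ℝ, ‖Complex.Gamma (σ + t * Complex.I)‖ ≤ C * Real.exp (-(θ * t)) := by
  have hθ' : |(θ * Complex.I).im| < Real.pi / 2 := by simpa using hθ
  refine ⟨∫ x : ℝ in Ioi 0, ‖(x : ℂ) ^ ((σ : ℂ) - 1) *
    Complex.exp (-(Complex.exp (θ * Complex.I) * x))‖, fun t => ?_⟩
  have hw : 0 < ((σ : ℂ) + t * Complex.I).re := by simpa using hσ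
  have h := integral_cpow_mul_cexp_neg_mul hw (re_exp_pos hθ')
  rw [log_exp_of_abs_im_lt hθ'] at h
  have h2 := norm_integral_le_integral_norm (μ := volume.restrict (Ioi 0)) (fun x : ℝ =>
    (x : ℂ) ^ (((σ : ℂ) + t * Complex.I) - 1) * Complex.exp (-(Complex.exp (θ * Complex.I) * x)))
  rw [h, norm_mul, Complex.norm_exp] at h2
  have h3 : (-(((σ : ℂ) + t * Complex.I) * (θ * Complex.I))).re = θ * t := by
    simp; ring
  rw [h3] at h2
  have h4 : ∫ x : ℝ in Ioi 0, ‖(x : ℂ) ^ (((σ : ℂ) + t * Complex.I) - 1) *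
      Complex.exp (-(Complex.exp (θ * Complex.I) * x))‖ = ∫ x : ℝ in Ioi 0,
      ‖(x : ℂ) ^ ((σ : ℂ) - 1) * Complex.exp (-(Complex.exp (θ * Complex.I) * x))‖ := by
    refine setIntegral_congr_fun measurableSet_Ioi fun x hx => ?_
    simp only [norm_mul, Complex.norm_cpow_eq_rpow_re_of_pos hx]
    simp
  rw [h4] at h2
  rw [Real.exp_neg, ← div_eq_mul_inv, le_div_iff₀ (Real.exp_pos _), mul_comm]
  exact h2

theorem integrable_exp_neg_mul_abs {k : ℝ} (hk : 0 < k) :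
    Integrable fun y : ℝ => Real.exp (-(k * |y|)) := by
  have h : IntegrableOn (fun y : ℝ => Real.exp (-(k * |y|))) (Ioi 0) := by
    refine (exp_neg_integrableOn_Ioi 0 hk).congr_fun (fun x hx => ?_) measurableSet_Ioi
    simp [abs_of_pos (show 0 < x from hx)]
  have h' : IntegrableOn (fun y : ℝ => Real.exp (-(k * |y|))) (Iio 0) := by
    have := IntegrableOn.comp_neg_Iio (c := 0) (f := fun y : ℝ => Real.exp (-(k * |y|))) (by rwa [neg_zero])
    simpa using this
  rw [← integrableOn_univ, ← Iic_union_Ioi (a := (0 : ℝ)), integrableOn_union,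
    integrableOn_Iic_iff_integrableOn_Iio]
  exact ⟨h', h⟩

theorem integrable_cexp_mul_Gamma_vertical {σ : ℝ} {B : ℂ} (hσ : 0 < σ)
    (hB : |B.im| < Real.pi / 2) :
    Integrable fun y : ℝ => Complex.exp (-((σ + y * Complex.I) * B)) *
      Complex.Gamma (σ + y * Complex.I) := by
  obtain ⟨θ, hθ1, hθ2⟩ := exists_between hB
  have hθ0 : 0 ≤ θ := (abs_nonneg _).trans hθ1.le
  obtain ⟨C₁, hC₁⟩ := norm_Gamma_vertical_le_of_abs_lt (θ := θ) hσ (by rwa [abs_of_nonneg hθ0])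
  obtain ⟨C₂, hC₂⟩ := norm_Gamma_vertical_le_of_abs_lt (θ := -θ) hσ
    (by rwa [abs_neg, abs_of_nonneg hθ0])
  have hΓ : ∀ t : ℝ, ‖Complex.Gamma (σ + t * Complex.I)‖ ≤ max C₁ C₂ * Real.exp (-(θ * |t|)) := by
    intro t
    rcases le_total 0 t with ht | ht
    · rw [abs_of_nonneg ht]
      exact (hC₁ t).trans (by gcongr; exact le_max_left _ _)
    · rw [abs_of_nonpos ht]
      refine (hC₂ t).trans ?_
      rw [neg_mul, mul_neg]
      gcongr
      exact le_max_right _ _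
  have hC : 0 ≤ max C₁ C₂ := by
    have := (norm_nonneg _).trans (hΓ 0)
    simpa using this
  refine Integrable.mono' (((integrable_exp_neg_mul_abs (sub_pos.2 hθ1)).const_mul
    (max C₁ C₂ * Real.exp (-(σ * B.re))))) ?_ (Eventually.of_forall fun y => ?_)
  · refine Continuous.aestronglyMeasurable ?_
    refine Continuous.mul (by fun_prop) (continuous_iff_continuousAt.2 fun y => ?_)
    refine ContinuousAt.comp (f := fun y : ℝ => (σ : ℂ) + y * Complex.I) (g := Complex.Gamma)
      (Complex.differentiableAt_Gamma _ fun m hm => ?_).continuousAt (by fun_prop)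
    have := congrArg Complex.re hm
    simp at this
    have : (0 : ℝ) ≤ m := m.cast_nonneg
    linarith
  · rw [norm_mul, Complex.norm_exp]
    have h1 : (-(((σ : ℂ) + y * Complex.I) * B)).re = -(σ * B.re) + y * B.im := by
      simp; ring
    have h2 : y * B.im ≤ |B.im| * |y| := by
      rw [← abs_mul, mul_comm]; exact le_abs_self _
    calc Real.exp (-(((σ : ℂ) + y * Complex.I) * B)).re * ‖Complex.Gamma (σ + y * Complex.I)‖
        ≤ Real.exp (-(σ * B.re) + |B.im| * |y|) * (max C₁ C₂ * Real.exp (-(θ * |y|))) := by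
          rw [h1]
          gcongr
          exact hΓ y
      _ = max C₁ C₂ * Real.exp (-(σ * B.re)) * Real.exp (-((θ - |B.im|) * |y|)) := by
          rw [show -((θ - |B.im|) * |y|) = |B.im| * |y| + -(θ * |y|) by ring, Real.exp_add,
            Real.exp_add]
          ring

theorem integral_cpow_mul_Gamma_vertical {σ x : ℝ} {B : ℂ} (hσ : 0 < σ) (hx : 0 < x)
    (hB : |B.im| < Real.pi / 2) :
    ∫ y : ℝ, (x : ℂ) ^ (-((σ : ℂ) + y * Complex.I)) *
      (Complex.exp (-((σ + y * Complex.I) * B)) * Complex.Gamma (σ + y * Complex.I)) =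
      2 * Real.pi * Complex.exp (-(Complex.exp B * x)) := by
  have hm : ∀ y : ℝ, mellin (fun x : ℝ => Complex.exp (-(Complex.exp B * x)))
      (σ + y * Complex.I) = Complex.exp (-((σ + y * Complex.I) * B)) *
        Complex.Gamma (σ + y * Complex.I) := by
    intro y
    have := integral_cpow_mul_cexp_neg_mul (w := σ + y * Complex.I) (by simpa using hσ)
      (re_exp_pos hB)
    rw [log_exp_of_abs_im_lt hB] at this
    simpa [mellin] using this
  have h := mellinInv_mellin_eq σ (fun x : ℝ => Complex.exp (-(Complex.exp B * x))) hx
    (by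
      simpa [MellinConvergent] using! integrableOn_cpow_mul_cexp_neg_mul (w := σ)
        (by simpa using hσ) (re_exp_pos hB))
    (by
      unfold Complex.VerticalIntegrable
      simp_rw [hm]
      exact integrable_cexp_mul_Gamma_vertical hσ hB)
    (by fun_prop)
  unfold mellinInv at h
  simp_rw [hm] at h
  rw [← h]
  have hpi : (Real.pi : ℂ) ≠ 0 := by exact_mod_cast Real.pi_ne_zero
  have h2 : 2 * (Real.pi : ℂ) * (1 / (2 * Real.pi)) = 1 := by field_simp
  simp only [smul_eq_mul, Complex.real_smul]
  push_cast
  rw [← mul_assoc, h2, one_mul]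

theorem integrable_and_integral_Gamma_mul_Gamma_vertical {s A B : ℂ} {σ : ℝ} (hσ : 0 < σ)
    (hσs : σ < s.re) (hA : |A.im| < Real.pi / 2) (hB : |B.im| < Real.pi / 2) :
    Integrable (fun y : ℝ => Complex.exp (-((s - (σ + y * Complex.I)) * A)) *
      Complex.Gamma (s - (σ + y * Complex.I)) * (Complex.exp (-((σ + y * Complex.I) * B)) *
        Complex.Gamma (σ + y * Complex.I))) ∧
    ∫ y : ℝ, Complex.exp (-((s - (σ + y * Complex.I)) * A)) *
      Complex.Gamma (s - (σ + y * Complex.I)) * (Complex.exp (-((σ + y * Complex.I) * B)) *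
        Complex.Gamma (σ + y * Complex.I)) =
      2 * Real.pi * (Complex.exp (-(s * Complex.log (Complex.exp A + Complex.exp B))) *
        Complex.Gamma s) := by
  set G : ℝ → ℂ := fun y => Complex.exp (-((σ + y * Complex.I) * B)) *
        Complex.Gamma (σ + y * Complex.I) with hG
  set P : ℝ → ℂ := fun x => (x : ℂ) ^ ((s - σ) - 1) * Complex.exp (-(Complex.exp A * x)) with hP
  have hGi : Integrable G := integrable_cexp_mul_Gamma_vertical hσ hB
  have hPi : IntegrableOn P (Ioi 0) :=
    integrableOn_cpow_mul_cexp_neg_mul (by simpa using hσs) (re_exp_pos hA)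
  have hprod : Integrable (fun z : ℝ × ℝ => (z.1 : ℂ) ^ (-(z.2 * Complex.I)) * (P z.1 * G z.2))
      ((volume.restrict (Ioi 0)).prod volume) := by
    refine (hPi.mul_prod hGi).bdd_mul (c := 1) ?_ ?_
    · exact Measurable.aestronglyMeasurable (by fun_prop)
    · have : ∀ᵐ z : ℝ × ℝ ∂((volume.restrict (Ioi 0)).prod volume), z.1 ∈ Ioi (0 : ℝ) :=
        Measure.quasiMeasurePreserving_fst.ae (ae_restrict_mem measurableSet_Ioi)
      filter_upwards [this] with z hz
      rw [Complex.norm_cpow_eq_rpow_re_of_pos hz]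
      simp
  have hx : ∀ y : ℝ, ∫ x : ℝ in Ioi 0, (x : ℂ) ^ (-(y * Complex.I)) * (P x * G y) =
      Complex.exp (-((s - (σ + y * Complex.I)) * A)) *
        Complex.Gamma (s - (σ + y * Complex.I)) * G y := by
    intro y
    have h := integral_cpow_mul_cexp_neg_mul (w := s - (σ + y * Complex.I)) (by simpa using hσs)
      (re_exp_pos hA)
    rw [log_exp_of_abs_im_lt hA] at h
    rw [← h, ← integral_mul_const]
    refine setIntegral_congr_fun measurableSet_Ioi fun x hx => ?_
    have hx0 : (x : ℂ) ≠ 0 := by exact_mod_cast (show 0 < x from hx).ne'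
    simp only [hP]
    rw [show s - (σ + y * Complex.I) - 1 = -(y * Complex.I) + (s - σ - 1) by ring,
      Complex.cpow_add _ _ hx0]
    ring
  have hy : ∫ x : ℝ in Ioi 0, ∫ y : ℝ, (x : ℂ) ^ (-(y * Complex.I)) * (P x * G y) =
      2 * Real.pi * (Complex.exp (-(s * Complex.log (Complex.exp A + Complex.exp B))) *
        Complex.Gamma s) := by
    have hre : 0 < (Complex.exp A + Complex.exp B).re := by
      have h1 := re_exp_pos hA
      have h2 := re_exp_pos hB
      rw [Complex.add_re]; linarith
    rw [← integral_cpow_mul_cexp_neg_mul (hσ.trans hσs) hre, ← integral_const_mul]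
    refine setIntegral_congr_fun measurableSet_Ioi fun x hx => ?_
    have hx0 : (x : ℂ) ≠ 0 := by exact_mod_cast (show 0 < x from hx).ne'
    have h := integral_cpow_mul_Gamma_vertical hσ hx hB
    have h2 : ∀ y : ℝ, (x : ℂ) ^ (-(y * Complex.I)) * (P x * G y) =
        ((x : ℂ) ^ (s - 1) * Complex.exp (-(Complex.exp A * x))) *
          ((x : ℂ) ^ (-((σ : ℂ) + y * Complex.I)) * G y) := by
      intro y
      have h3 : (x : ℂ) ^ (-(y * Complex.I)) * (x : ℂ) ^ (s - σ - 1) =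
          (x : ℂ) ^ (s - 1) * (x : ℂ) ^ (-((σ : ℂ) + y * Complex.I)) := by
        rw [← Complex.cpow_add _ _ hx0, ← Complex.cpow_add _ _ hx0]
        ring_nf
      simp only [hP]
      linear_combination (Complex.exp (-(Complex.exp A * x)) * G y) * h3
    simp only [h2]
    rw [integral_const_mul, h, add_mul, neg_add, Complex.exp_add]
    ring
  have hswap := integral_integral_swap
    (f := fun x y : ℝ => (x : ℂ) ^ (-(y * Complex.I)) * (P x * G y)) hprod
  have hint := hprod.integral_prod_right
  simp only [hx] at hswap hint
  exact ⟨hint, hswap.symm.trans hy⟩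


/-- the Mellin–Barnes integral formula. -/
theorem stmt_2 (s lam : ℂ) (hs : 0 < s.re) (hlam : lam ≠ 0)
    (harg : |Complex.arg lam| < Real.pi) (c : ℝ) (hc1 : -s.re < c) (hc2 : c < 0) :
    MeasureTheory.Integrable (fun t : ℝ =>
      Complex.Gamma (s + ((c : ℂ) + (t : ℂ) * Complex.I)) *
        Complex.Gamma (-((c : ℂ) + (t : ℂ) * Complex.I)) *
        lam ^ ((c : ℂ) + (t : ℂ) * Complex.I)) ∧
    (1 + lam) ^ (-s) =
      (1 / (2 * (Real.pi : ℂ) * Complex.Gamma s)) *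
        ∫ t : ℝ, Complex.Gamma (s + ((c : ℂ) + (t : ℂ) * Complex.I)) *
          Complex.Gamma (-((c : ℂ) + (t : ℂ) * Complex.I)) *
          lam ^ ((c : ℂ) + (t : ℂ) * Complex.I) := by
  set L := Complex.log lam with hL
  set φ : ℝ := Complex.arg lam / 2 with hφ
  have hLim : L.im = 2 * φ := by rw [hL, Complex.log_im]; ring
  have hφ' : |φ| < Real.pi / 2 := by
    rw [hφ, abs_div, abs_two]; linarith
  set A : ℂ := -(φ * Complex.I) with hAdef
  set B : ℂ := L + A with hBdef
  have hAim : A.im = -φ := by simp [hAdef]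
  have hA : |A.im| < Real.pi / 2 := by rwa [hAim, abs_neg]
  have hB : |B.im| < Real.pi / 2 := by
    rw [hBdef, Complex.add_im, hLim, hAim]
    convert hφ' using 2
    ring
  have hΓs : Complex.Gamma s ≠ 0 := Complex.Gamma_ne_zero_of_re_pos hs
  have hBexp : Complex.exp B = lam * Complex.exp A := by
    rw [hBdef, Complex.exp_add, hL, Complex.exp_log hlam]
  have hsum : Complex.exp A + Complex.exp B = Complex.exp A * (1 + lam) := by rw [hBexp]; ring
  have hre : 0 < (Complex.exp A + Complex.exp B).re := by
    rw [Complex.add_re]; exact add_pos (re_exp_pos hA) (re_exp_pos hB)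
  have hne : (1 : ℂ) + lam ≠ 0 := by
    intro h
    rw [hsum, h] at hre
    simp at hre
  have hlog : Complex.log (1 + lam) = Complex.log (Complex.exp A + Complex.exp B) - A := by
    have harg' : |Complex.arg (Complex.exp A + Complex.exp B)| < Real.pi / 2 :=
      Complex.abs_arg_lt_pi_div_two_iff.2 (Or.inl hre)
    rw [abs_lt] at harg' hA
    have h0 : Complex.exp A + Complex.exp B ≠ 0 := by
      intro h; simp [h] at hre
    rw [← Complex.log_exp (x := Complex.log (Complex.exp A + Complex.exp B) - A), Complex.exp_sub,
      Complex.exp_log h0, hsum, mul_div_cancel_left₀ _ (Complex.exp_ne_zero A)]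
    · rw [Complex.sub_im, Complex.log_im]; linarith
    · rw [Complex.sub_im, Complex.log_im]; linarith
  obtain ⟨hint, heq⟩ := integrable_and_integral_Gamma_mul_Gamma_vertical (s := s) (σ := -c)
    (by linarith) (by linarith) hA hB
  have hfun : ∀ t : ℝ, Complex.Gamma (s + ((c : ℂ) + (t : ℂ) * Complex.I)) *
        Complex.Gamma (-((c : ℂ) + (t : ℂ) * Complex.I)) *
        lam ^ ((c : ℂ) + (t : ℂ) * Complex.I) = Complex.exp (s * A) *
      (Complex.exp (-((s - ((-c : ℝ) + (-t : ℝ) * Complex.I)) * A)) *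
      Complex.Gamma (s - ((-c : ℝ) + (-t : ℝ) * Complex.I)) *
      (Complex.exp (-(((-c : ℝ) + (-t : ℝ) * Complex.I) * B)) *
        Complex.Gamma ((-c : ℝ) + (-t : ℝ) * Complex.I))) := by
    intro t
    have e : ((-c : ℝ) : ℂ) + (-t : ℝ) * Complex.I = -((c : ℂ) + t * Complex.I) := by
      push_cast; ring
    rw [e, sub_neg_eq_add, Complex.cpow_def_of_ne_zero hlam, ← hL,
      show L * ((c : ℂ) + t * Complex.I) = s * A + -((s + (c + t * Complex.I)) * A) +
        -(-((c : ℂ) + t * Complex.I) * B) by rw [hBdef]; ring, Complex.exp_add, Complex.exp_add]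
    ring
  simp only [hfun]
  refine ⟨hint.comp_neg.const_mul _, ?_⟩
  rw [integral_const_mul, integral_neg_eq_self (fun t : ℝ =>
      Complex.exp (-((s - ((-c : ℝ) + (t : ℝ) * Complex.I)) * A)) *
      Complex.Gamma (s - ((-c : ℝ) + (t : ℝ) * Complex.I)) *
      (Complex.exp (-(((-c : ℝ) + (t : ℝ) * Complex.I) * B)) *
        Complex.Gamma ((-c : ℝ) + (t : ℝ) * Complex.I))), heq,
    Complex.cpow_def_of_ne_zero hne, hlog,
    show (Complex.log (Complex.exp A + Complex.exp B) - A) * -s =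
      s * A + -(s * Complex.log (Complex.exp A + Complex.exp B)) by ring, Complex.exp_add]
  have : (Real.pi : ℂ) ≠ 0 := by exact_mod_cast Real.pi_ne_zero
  field_simp
end

section
/- Let r ≥ 1, let s, λ_0,…,λ_r ∈ ℂ with Re λ_j > 0 for all 0 ≤ j ≤ r, and let ρ_1,…,ρ_r > 0 with Re s > ρ_1+…+ρ_r. Then (λ_0+λ_1+…+λ_r)^{−s} = (1/(2π)^r)·∫_{ℝ^r} Γ(s−Σ_{j=1}^r(ρ_j+it_j))·∏_{j=1}^r Γ(ρ_j+it_j) / ( Γ(s)·λ_0^{s−Σ_{j=1}^r(ρ_j+it_j)}·∏_{j=1}^r λ_j^{ρ_j+it_j} ) dt_1⋯dt_r, the iterated integrals converging absolutely. -/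
open MeasureTheory Set Filter Topology

namespace Complex

lemma norm_cpow_sub_one_mul_exp_neg_mul (a l : ℂ) {x : ℝ} (hx : 0 < x) :
    ‖(x : ℂ) ^ (a - 1) * exp (-(l * x))‖ = x ^ (a.re - 1) * Real.exp (-l.re * x) := by
  rw [norm_mul, norm_cpow_eq_rpow_re_of_pos hx, norm_exp]
  simp

lemma integrableOn_cpow_mul_exp_neg_mul_Ioi {a l : ℂ} (ha : 0 < a.re) (hl : 0 < l.re) :
    IntegrableOn (fun x : ℝ => (x : ℂ) ^ (a - 1) * exp (-(l * x))) (Ioi 0) := by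
  have h : IntegrableOn (fun x : ℝ => x ^ (a.re - 1) * Real.exp (-l.re * x)) (Ioi 0) := by
    simpa using integrableOn_rpow_mul_exp_neg_mul_rpow (s := a.re - 1) (p := 1)
      (by linarith) one_pos hl
  refine Integrable.mono' h ?_ ?_
  · refine ContinuousOn.aestronglyMeasurable (fun x hx => ?_) measurableSet_Ioi
    have : (x : ℂ) ∈ slitPlane := Or.inl (by simpa using hx)
    exact ContinuousAt.continuousWithinAt
      (((continuousAt_cpow_const this).comp continuous_ofReal.continuousAt).mul (by fun_prop))
  · exact (ae_restrict_mem measurableSet_Ioi).mono fun x hx =>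
      (norm_cpow_sub_one_mul_exp_neg_mul a l hx).le

lemma differentiableOn_integral_cpow_mul_exp_neg_mul_Ioi {a : ℂ} (ha : 0 < a.re) :
    DifferentiableOn ℂ (fun l : ℂ => ∫ x : ℝ in Ioi 0, (x : ℂ) ^ (a - 1) * exp (-(l * x)))
      {l | 0 < l.re} := by
  intro l hl
  have hl : 0 < l.re := hl
  set s : Set ℂ := {z | l.re / 2 < z.re}
  have hs : s ∈ 𝓝 l :=
    (isOpen_lt continuous_const continuous_re).mem_nhds (by show l.re / 2 < l.re; linarith)
  have hb : IntegrableOn (fun x : ℝ => x ^ ((a + 1).re - 1) * Real.exp (-(l / 2).re * x))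
      (Ioi 0) := by
    have := integrableOn_rpow_mul_exp_neg_mul_rpow (s := (a + 1).re - 1) (p := 1) (b := (l / 2).re)
      (by simp; linarith) one_pos (by simp; linarith)
    simpa using this
  refine (hasDerivAt_integral_of_dominated_loc_of_deriv_le (μ := volume.restrict (Ioi (0 : ℝ)))
    (F := fun (l : ℂ) (x : ℝ) => (x : ℂ) ^ (a - 1) * exp (-(l * x)))
    (F' := fun (l : ℂ) (x : ℝ) => (x : ℂ) ^ (a - 1) * (exp (-(l * x)) * (-x)))
    hs ?_ (integrableOn_cpow_mul_exp_neg_mul_Ioi ha hl) ?_ ?_ hb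
    ?_).2.differentiableAt.differentiableWithinAt
  · filter_upwards [hs] with z hz
    exact (integrableOn_cpow_mul_exp_neg_mul_Ioi ha
      (lt_trans (by linarith) hz)).aestronglyMeasurable
  · simp_rw [← mul_assoc]
    exact (integrableOn_cpow_mul_exp_neg_mul_Ioi ha hl).aestronglyMeasurable.mul
      (by fun_prop)
  · filter_upwards [ae_restrict_mem measurableSet_Ioi] with x hx z hz
    have hx : 0 < x := hx
    rw [← mul_assoc, norm_mul, norm_cpow_sub_one_mul_exp_neg_mul a z hx, norm_neg,
      norm_real, Real.norm_of_nonneg hx.le]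
    have h1 : x ^ ((a + 1).re - 1) = x ^ (a.re - 1) * x := by
      rw [← Real.rpow_add_one hx.ne']; simp
    have h2 : Real.exp (-z.re * x) ≤ Real.exp (-(l / 2).re * x) := by
      apply Real.exp_le_exp.2
      have : l.re / 2 < z.re := hz
      have h3 : (l / 2).re = l.re / 2 := by simp
      rw [h3]
      nlinarith
    rw [h1, mul_right_comm]
    gcongr
  · refine .of_forall fun x z _ => ?_
    have : HasDerivAt (fun z : ℂ => -(z * x)) (-(x : ℂ)) z := by
      simpa using ((hasDerivAt_id' z).mul_const (x : ℂ)).fun_neg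
    exact this.cexp.const_mul _

/-- The Gamma integral rotated to a ray in the right half-plane. -/
theorem integral_cpow_mul_exp_neg_mul_Ioi_of_re_pos {a l : ℂ} (ha : 0 < a.re) (hl : 0 < l.re) :
    ∫ x : ℝ in Ioi 0, (x : ℂ) ^ (a - 1) * exp (-(l * x)) = Gamma a * l ^ (-a) := by
  have ho : IsOpen {l : ℂ | 0 < l.re} := isOpen_lt continuous_const continuous_re
  have hF := (differentiableOn_integral_cpow_mul_exp_neg_mul_Ioi ha).analyticOnNhd ho
  have hG : AnalyticOnNhd ℂ (fun l : ℂ => Gamma a * l ^ (-a)) {l | 0 < l.re} := by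
    refine DifferentiableOn.analyticOnNhd (fun z hz => ?_) ho
    exact ((differentiableAt_id.cpow_const (Or.inl hz)).const_mul _).differentiableWithinAt
  refine hF.eqOn_of_preconnected_of_frequently_eq hG
    (convex_halfSpace_re_gt 0).isPreconnected (z₀ := 1) (by simp) ?_ hl
  have ht : Tendsto ((↑) : ℝ → ℂ) (𝓝[≠] 1) (𝓝[≠] 1) := by
    refine tendsto_nhdsWithin_iff.2 ⟨?_, ?_⟩
    · exact (continuous_ofReal.tendsto' 1 1 (by simp)).mono_left nhdsWithin_le_nhds
    · filter_upwards [self_mem_nhdsWithin] with x hx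
      simpa using hx
  refine ht.frequently (Eventually.frequently ?_)
  filter_upwards [nhdsWithin_le_nhds (lt_mem_nhds (zero_lt_one' ℝ))] with x hx
  rw [integral_cpow_mul_exp_neg_mul_Ioi ha hx, one_div, inv_cpow _ _ (by
    rw [arg_ofReal_of_nonneg hx.le]; exact Real.pi_pos.ne), cpow_neg, mul_comm]

lemma mellin_exp_neg_mul {a l : ℂ} (ha : 0 < a.re) (hl : 0 < l.re) :
    mellin (fun x : ℝ => exp (-(l * x))) a = Gamma a * l ^ (-a) :=
  integral_cpow_mul_exp_neg_mul_Ioi_of_re_pos ha hl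

lemma norm_cpow_neg {l : ℂ} (hl : l ≠ 0) (z : ℂ) :
    ‖l ^ (-z)‖ = ‖l‖ ^ (-z.re) * Real.exp (arg l * z.im) := by
  rw [norm_cpow_of_ne_zero hl, neg_re, neg_im, mul_neg, Real.exp_neg, div_inv_eq_mul]

lemma norm_Gamma_mul_exp_le {z : ℂ} (hz : 0 < z.re) {θ : ℝ} (hθ : |θ| < Real.pi / 2) :
    ‖Gamma z‖ * Real.exp (θ * z.im) ≤ Real.Gamma z.re * Real.cos θ ^ (-z.re) := by
  have h1 := abs_lt.1 hθ
  have hc : 0 < Real.cos θ := Real.cos_pos_of_mem_Ioo h1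
  set l : ℂ := exp (θ * I)
  have hlre : l.re = Real.cos θ := exp_ofReal_mul_I_re θ
  have harg : arg l = θ := by
    rw [arg_exp_mul_I]
    exact (toIocMod_eq_self _).2 ⟨by linarith [Real.pi_pos], by linarith [Real.pi_pos]⟩
  have hl : 0 < l.re := hlre ▸ hc
  have hn : ‖Gamma z * l ^ (-z)‖ = ‖Gamma z‖ * Real.exp (θ * z.im) := by
    rw [norm_mul, norm_cpow_neg (exp_ne_zero _), harg, norm_exp_ofReal_mul_I, Real.one_rpow,
      one_mul]
  rw [← hn, ← integral_cpow_mul_exp_neg_mul_Ioi_of_re_pos hz hl]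
  refine (norm_integral_le_integral_norm _).trans_eq ?_
  rw [setIntegral_congr_fun measurableSet_Ioi
    (fun x hx => norm_cpow_sub_one_mul_exp_neg_mul z l hx)]
  simp_rw [neg_mul]
  rw [Real.integral_rpow_mul_exp_neg_mul_Ioi hz hl, hlre, one_div, Real.inv_rpow hc.le,
    Real.rpow_neg hc.le, mul_comm]

lemma continuous_Gamma_mul_cpow_neg_vertical {ρ : ℝ} (hρ : 0 < ρ) {l : ℂ} (hl : l ≠ 0) :
    Continuous fun t : ℝ => Gamma (ρ + t * I) * l ^ (-(ρ + t * I : ℂ)) := by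
  refine Continuous.mul (continuous_iff_continuousAt.2 fun t => ?_) ?_
  · refine ContinuousAt.comp (g := Gamma) (differentiableAt_Gamma _ fun m h => ?_).continuousAt
      (by fun_prop)
    have := congrArg re h
    simp at this
    linarith [(Nat.cast_nonneg m : (0 : ℝ) ≤ m)]
  · exact Continuous.const_cpow (by fun_prop) (Or.inl hl)

lemma integrable_exp_neg_mul_abs {δ : ℝ} (hδ : 0 < δ) :
    Integrable fun t : ℝ => Real.exp (-(δ * |t|)) := by
  rw [← integrableOn_univ, ← Iic_union_Ioi (a := (0 : ℝ)), integrableOn_union]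
  constructor
  · refine (integrableOn_exp_mul_Iic hδ 0).congr_fun (fun t ht => ?_) measurableSet_Iic
    simp [abs_of_nonpos (mem_Iic.1 ht)]
  · refine (integrableOn_exp_mul_Ioi (neg_neg_of_pos hδ) 0).congr_fun (fun t ht => ?_)
      measurableSet_Ioi
    simp [abs_of_pos (mem_Ioi.1 ht)]

lemma integrable_Gamma_mul_cpow_neg_vertical {ρ : ℝ} (hρ : 0 < ρ) {l : ℂ} (hl : 0 < l.re) :
    Integrable fun t : ℝ => Gamma (ρ + t * I) * l ^ (-(ρ + t * I : ℂ)) := by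
  have hl0 : l ≠ 0 := by rintro rfl; simp at hl
  have harg : |arg l| < Real.pi / 2 := abs_arg_lt_pi_div_two_iff.2 (Or.inl hl)
  obtain ⟨θ, h1, h2⟩ := exists_between harg
  have hθ0 : 0 < θ := (abs_nonneg _).trans_lt h1
  set δ := θ - |arg l|
  have hδ : 0 < δ := sub_pos.2 h1
  set C := Real.Gamma ρ * Real.cos θ ^ (-ρ) * ‖l‖ ^ (-ρ)
  have hexp := (integrable_exp_neg_mul_abs hδ).const_mul C
  refine hexp.mono'
    (continuous_Gamma_mul_cpow_neg_vertical hρ hl0).aestronglyMeasurable (.of_forall fun t => ?_)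
  have key : ‖Gamma (ρ + t * I)‖ * Real.exp (θ * |t|) ≤ Real.Gamma ρ * Real.cos θ ^ (-ρ) := by
    have hz : 0 < (ρ + t * I : ℂ).re := by simpa
    rcases abs_cases t with ⟨h, -⟩ | ⟨h, -⟩
    · simpa [h] using norm_Gamma_mul_exp_le hz (θ := θ) (by rwa [abs_of_pos hθ0])
    · simpa [h] using norm_Gamma_mul_exp_le hz (θ := -θ) (by rwa [abs_neg, abs_of_pos hθ0])
  have hle : Real.exp (arg l * t) ≤ Real.exp (θ * |t|) * Real.exp (-(δ * |t|)) := by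
    rw [← Real.exp_add]
    apply Real.exp_le_exp.2
    calc arg l * t ≤ |arg l * t| := le_abs_self _
      _ = θ * |t| + -(δ * |t|) := by rw [abs_mul]; ring
  calc ‖Gamma (ρ + t * I) * l ^ (-(ρ + t * I : ℂ))‖
      = ‖Gamma (ρ + t * I)‖ * (‖l‖ ^ (-ρ) * Real.exp (arg l * t)) := by
        rw [norm_mul, norm_cpow_neg hl0]; simp
    _ ≤ ‖Gamma (ρ + t * I)‖ * (‖l‖ ^ (-ρ) * (Real.exp (θ * |t|) * Real.exp (-(δ * |t|)))) := by
        gcongr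
    _ = (‖Gamma (ρ + t * I)‖ * Real.exp (θ * |t|)) * (‖l‖ ^ (-ρ) * Real.exp (-(δ * |t|))) := by
        ring
    _ ≤ (Real.Gamma ρ * Real.cos θ ^ (-ρ)) * (‖l‖ ^ (-ρ) * Real.exp (-(δ * |t|))) := by
        gcongr
    _ = C * Real.exp (-(δ * |t|)) := by ring

/-- The Cahen–Mellin integral. -/
theorem integral_Gamma_mul_cpow_neg_vertical {ρ : ℝ} (hρ : 0 < ρ) {l : ℂ} (hl : 0 < l.re)
    {x : ℝ} (hx : 0 < x) :
    1 / (2 * (Real.pi : ℂ)) * ∫ t : ℝ, (x : ℂ) ^ (-(ρ + t * I : ℂ)) *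
      (Gamma (ρ + t * I) * l ^ (-(ρ + t * I : ℂ))) = exp (-(l * x)) := by
  have hm (t : ℝ) : mellin (fun x : ℝ => exp (-(l * x))) (ρ + t * I) =
      Gamma (ρ + t * I) * l ^ (-(ρ + t * I : ℂ)) := mellin_exp_neg_mul (by simpa) hl
  have := mellinInv_mellin_eq ρ (fun x : ℝ => exp (-(l * x))) hx
    (integrableOn_cpow_mul_exp_neg_mul_Ioi (by simpa) hl)
    (by simpa only [VerticalIntegrable, hm] using integrable_Gamma_mul_cpow_neg_vertical hρ hl)
    (by fun_prop)
  rw [← this, mellinInv]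
  simp [hm]

lemma cpow_sum {ι : Type*} {x : ℂ} (hx : x ≠ 0) (S : Finset ι) (f : ι → ℂ) :
    x ^ ∑ i ∈ S, f i = ∏ i ∈ S, x ^ f i := by
  simp_rw [cpow_def_of_ne_zero hx, Finset.mul_sum, exp_sum]

lemma integrable_prod_Gamma_mul_cpow_mul_exp_neg {ι : Type*} [Fintype ι] {s l₀ : ℂ} {l : ι → ℂ}
    {ρ : ι → ℝ} (hl₀ : 0 < l₀.re) (hl : ∀ j, 0 < (l j).re) (hρ : ∀ j, 0 < ρ j)
    (hs : ∑ j, ρ j < s.re) :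
    Integrable (fun p : (ι → ℝ) × ℝ =>
      (∏ j, (Gamma (ρ j + p.1 j * I) * l j ^ (-(ρ j + p.1 j * I : ℂ)))) *
        ((p.2 : ℂ) ^ (s - ∑ j, (ρ j + p.1 j * I : ℂ) - 1) * exp (-(l₀ * p.2))))
      (volume.prod (volume.restrict (Ioi 0))) := by
  have hsρ : 0 < (s - ∑ j, (ρ j : ℂ)).re := by simpa using hs
  have h1 : Integrable (fun t : ι → ℝ =>
      ∏ j, (Gamma (ρ j + t j * I) * l j ^ (-(ρ j + t j * I : ℂ)))) :=
    Integrable.fintype_prod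
      (f := fun j (t : ℝ) => Gamma (ρ j + t * I) * l j ^ (-(ρ j + t * I : ℂ)))
      fun j => integrable_Gamma_mul_cpow_neg_vertical (hρ j) (hl j)
  have hx : ∀ᵐ p : (ι → ℝ) × ℝ ∂(volume.prod (volume.restrict (Ioi 0))), 0 < p.2 :=
    Measure.quasiMeasurePreserving_snd.ae (ae_restrict_mem measurableSet_Ioi)
  refine ((h1.mul_prod (integrableOn_cpow_mul_exp_neg_mul_Ioi hsρ hl₀)).bdd_mul
    (f := fun p : (ι → ℝ) × ℝ => (p.2 : ℂ) ^ (-((∑ j, p.1 j : ℝ) * I)))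
    (c := 1) (Measurable.aestronglyMeasurable (by fun_prop)) ?_).congr ?_
  · filter_upwards [hx] with p hp
    rw [norm_cpow_eq_rpow_re_of_pos hp]
    simp
  · filter_upwards [hx] with p hp
    have hp0 : (p.2 : ℂ) ≠ 0 := ofReal_ne_zero.2 hp.ne'
    have : s - ∑ j, (ρ j + p.1 j * I : ℂ) - 1 =
        -((∑ j, p.1 j : ℝ) * I) + (s - ∑ j, (ρ j : ℂ) - 1) := by
      rw [Finset.sum_add_distrib, ← Finset.sum_mul]
      push_cast
      ring
    rw [this, cpow_add _ _ hp0]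
    ring

lemma integral_prod_Gamma_mul_cpow_mul_exp_neg {ι : Type*} [Fintype ι] (s l₀ : ℂ) {l : ι → ℂ}
    {ρ : ι → ℝ} (hl : ∀ j, 0 < (l j).re) (hρ : ∀ j, 0 < ρ j) {x : ℝ} (hx : 0 < x) :
    (1 / (2 * (Real.pi : ℂ))) ^ Fintype.card ι * ∫ t : ι → ℝ,
      (∏ j, (Gamma (ρ j + t j * I) * l j ^ (-(ρ j + t j * I : ℂ)))) *
        ((x : ℂ) ^ (s - ∑ j, (ρ j + t j * I : ℂ) - 1) * exp (-(l₀ * x))) =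
      (x : ℂ) ^ (s - 1) * exp (-((l₀ + ∑ j, l j) * x)) := by
  have hx0 : (x : ℂ) ≠ 0 := ofReal_ne_zero.2 hx.ne'
  have h (t : ι → ℝ) : (∏ j, (Gamma (ρ j + t j * I) * l j ^ (-(ρ j + t j * I : ℂ)))) *
        ((x : ℂ) ^ (s - ∑ j, (ρ j + t j * I : ℂ) - 1) * exp (-(l₀ * x))) =
      (x : ℂ) ^ (s - 1) * exp (-(l₀ * x)) * ∏ j, ((x : ℂ) ^ (-(ρ j + t j * I : ℂ)) *
        (Gamma (ρ j + t j * I) * l j ^ (-(ρ j + t j * I : ℂ)))) := by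
    have : s - ∑ j, (ρ j + t j * I : ℂ) - 1 = (s - 1) + ∑ j, -(ρ j + t j * I : ℂ) := by
      rw [Finset.sum_neg_distrib]
      ring
    rw [this, cpow_add _ _ hx0, Finset.prod_mul_distrib (f := fun j => (x : ℂ) ^ _),
      cpow_sum hx0]
    ring
  simp_rw [h]
  rw [integral_const_mul, integral_fintype_prod_volume_eq_prod
    (f := fun j (t : ℝ) => (x : ℂ) ^ (-(ρ j + t * I : ℂ)) *
        (Gamma (ρ j + t * I) * l j ^ (-(ρ j + t * I : ℂ)))), mul_left_comm,
    ← Finset.card_univ, ← Finset.prod_const, ← Finset.prod_mul_distrib]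
  simp_rw [integral_Gamma_mul_cpow_neg_vertical (hρ _) (hl _) hx]
  rw [← exp_sum, mul_assoc, ← exp_add, Finset.sum_neg_distrib, ← Finset.sum_mul]
  ring_nf

end Complex


/-- the multiple Mellin–Barnes integral formula. -/
theorem stmt_3 (r : ℕ) (hr : 1 ≤ r) (s : ℂ) (lam : Fin (r + 1) → ℂ)
    (hlam : ∀ j, 0 < (lam j).re) (ρ : Fin r → ℝ) (hρ : ∀ j, 0 < ρ j)
    (hs : ∑ j, ρ j < s.re) :
    MeasureTheory.Integrable (fun t : Fin r → ℝ =>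
      Complex.Gamma (s - ∑ j, ((ρ j : ℂ) + (t j : ℂ) * Complex.I)) *
        (∏ j, Complex.Gamma ((ρ j : ℂ) + (t j : ℂ) * Complex.I)) /
        (Complex.Gamma s * lam 0 ^ (s - ∑ j, ((ρ j : ℂ) + (t j : ℂ) * Complex.I)) *
          ∏ j, lam j.succ ^ ((ρ j : ℂ) + (t j : ℂ) * Complex.I))) ∧
    (∑ j, lam j) ^ (-s) =
      (1 / (2 * (Real.pi : ℂ))) ^ r *
        ∫ t : Fin r → ℝ,
          Complex.Gamma (s - ∑ j, ((ρ j : ℂ) + (t j : ℂ) * Complex.I)) *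
            (∏ j, Complex.Gamma ((ρ j : ℂ) + (t j : ℂ) * Complex.I)) /
            (Complex.Gamma s * lam 0 ^ (s - ∑ j, ((ρ j : ℂ) + (t j : ℂ) * Complex.I)) *
              ∏ j, lam j.succ ^ ((ρ j : ℂ) + (t j : ℂ) * Complex.I)) := by
  have hs0 : 0 < s.re := (Finset.sum_nonneg fun j _ => (hρ j).le).trans_lt hs
  have hΓ : Complex.Gamma s ≠ 0 := Complex.Gamma_ne_zero_of_re_pos hs0
  have hF := Complex.integrable_prod_Gamma_mul_cpow_mul_exp_neg (hlam 0)
    (fun j : Fin r => hlam j.succ) hρ hs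
  have hinner (t : Fin r → ℝ) :
      (Complex.Gamma s)⁻¹ * ∫ x : ℝ in Ioi 0, (∏ j, (Complex.Gamma (ρ j + t j * Complex.I) *
          lam j.succ ^ (-(ρ j + t j * Complex.I : ℂ)))) *
        ((x : ℂ) ^ (s - ∑ j, (ρ j + t j * Complex.I : ℂ) - 1) * Complex.exp (-(lam 0 * x))) =
      Complex.Gamma (s - ∑ j, ((ρ j : ℂ) + (t j : ℂ) * Complex.I)) *
        (∏ j, Complex.Gamma ((ρ j : ℂ) + (t j : ℂ) * Complex.I)) /
        (Complex.Gamma s * lam 0 ^ (s - ∑ j, ((ρ j : ℂ) + (t j : ℂ) * Complex.I)) *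
          ∏ j, lam j.succ ^ ((ρ j : ℂ) + (t j : ℂ) * Complex.I)) := by
    rw [integral_const_mul, Complex.integral_cpow_mul_exp_neg_mul_Ioi_of_re_pos
      (by simpa using hs) (hlam 0), Finset.prod_mul_distrib]
    simp_rw [Complex.cpow_neg]
    rw [Finset.prod_inv_distrib, div_eq_mul_inv, mul_inv, mul_inv]
    ring
  simp_rw [← hinner]
  refine ⟨hF.integral_prod_left.const_mul _, ?_⟩
  have hsum : 0 < (∑ j, lam j).re := by
    rw [Complex.re_sum]
    exact Finset.sum_pos (fun j _ => hlam j) Finset.univ_nonempty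
  rw [integral_const_mul, integral_integral_swap hF, mul_left_comm, ← integral_const_mul,
    eq_inv_mul_iff_mul_eq₀ hΓ, ← Complex.integral_cpow_mul_exp_neg_mul_Ioi_of_re_pos hs0 hsum]
  refine setIntegral_congr_fun measurableSet_Ioi fun x hx => ?_
  have := Complex.integral_prod_Gamma_mul_cpow_mul_exp_neg s (lam 0)
    (fun j : Fin r => hlam j.succ) hρ hx
  rw [Fintype.card_fin, ← Fin.sum_univ_succ] at this
  exact this.symm
end

section
/- Let P(X) = c_0X^{a_0}+c_1X^{a_1}+…+c_dX^{a_d} with d ≥ 1, integers 0 ≤ a_0 < a_1 < … < a_d, and c_0,…,c_d > 0; set α_j := a_j − a_0. Let N ∈ ℕ₀, and let Z be any holomorphic function on an open connected set U ⊆ ℂ containing −N and a half-plane {Re s > σ} on which the series ζ_1(s) := Σ_{m≥1} P(m)^{−s} converges absolutely, with Z equal to the series there (such (U,Z) exist and all give the same value). Then Z(−N) = −c_0^N·Σ_{k=(k_1,…,k_d)∈ℕ₀^d, |k| ≤ N} [N!/(k_1!⋯k_d!·(N−|k|)!)]·[B̃_{a_0N+α_1k_1+…+α_dk_d+1}/(a_0N+α_1k_1+…+α_dk_d+1)]·∏_{j=1}^d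 (c_j/c_0)^{k_j} + Σ_{i=0}^{⌊(a_dN+1)/α_d⌋} Σ_{ℓ=(ℓ_1,…,ℓ_{d−1})∈ℕ₀^{d−1} with Σ_{j=1}^{d−1}(a_d−a_j)ℓ_j = 1+a_dN−iα_d} [(−1)^{|ℓ|+i+N}·(|ℓ|+i−N−1)!·N!/(a_d·i!·ℓ_1!⋯ℓ_{d−1}!)]·c_0^{i}·c_d^{N−i}·∏_{j=1}^{d−1}(c_j/c_d)^{ℓ_j}, where |k| := k_1+…+k_d and |ℓ| := ℓ_1+…+ℓ_{d−1}. -/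
lemma meromorphic_riemannZeta (z : ℂ) : MeromorphicAt riemannZeta z := by
  have hd : ∀ z : ℂ, z ≠ 1 → AnalyticAt ℂ riemannZeta z := fun z hz ↦ by
    refine DifferentiableOn.analyticAt (s := {1}ᶜ)
      (fun w hw ↦ (differentiableAt_riemannZeta hw).differentiableWithinAt) ?_
    exact isOpen_compl_singleton.mem_nhds hz
  by_cases hz : z = 1
  · subst hz
    have h : AnalyticAt ℂ (Function.update (fun s ↦ (s - 1) * riemannZeta s) 1 1) 1 := by
      refine Complex.analyticAt_of_differentiable_on_punctured_nhds_of_continuousAt ?_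
        (continuousAt_update_same.2 riemannZeta_residue_one)
      filter_upwards [self_mem_nhdsWithin] with w hw
      have : DifferentiableAt ℂ (fun s ↦ (s - 1) * riemannZeta s) w :=
        (differentiableAt_id.sub_const 1).mul (differentiableAt_riemannZeta hw)
      refine this.congr_of_eventuallyEq ?_
      filter_upwards [isOpen_compl_singleton.mem_nhds hw] with v hv
      exact Function.update_of_ne hv _ _
    have h2 : MeromorphicAt (fun s : ℂ ↦ (s - 1)⁻¹ *
        Function.update (fun s ↦ (s - 1) * riemannZeta s) 1 1 s) 1 :=
      (by fun_prop : MeromorphicAt (fun s : ℂ ↦ (s - 1)⁻¹) 1).mul h.meromorphicAt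
    refine h2.congr ?_
    filter_upwards [self_mem_nhdsWithin] with w hw
    rw [Function.update_of_ne hw, inv_mul_cancel_left₀ (sub_ne_zero.2 hw)]
  · exact (hd z hz).meromorphicAt

/-- The generalized binomial coefficient `w (w - 1) ⋯ (w - L + 1) / L!`. -/
noncomputable def binomCoeff (w : ℂ) (L : ℕ) : ℂ :=
  (∏ i ∈ Finset.range L, (w - i)) / (L.factorial : ℂ)

/-- The remainder of order `K` in the binomial series of `(1 + u) ^ w`. -/
noncomputable def binomRemainder (K : ℕ) (w u : ℂ) : ℂ :=
  (1 + u) ^ w - ∑ L ∈ Finset.range K, binomCoeff w L * u ^ L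

lemma binomCoeff_succ (w : ℂ) (L : ℕ) :
    binomCoeff w (L + 1) * (L + 1) = w * binomCoeff (w - 1) L := by
  have h1 : ((L : ℂ) + 1) ≠ 0 := by exact_mod_cast L.succ_ne_zero
  have h2 : ((L.factorial : ℂ)) ≠ 0 := by exact_mod_cast L.factorial_ne_zero
  have h3 : ∏ i ∈ Finset.range L, (w - 1 - i) = ∏ i ∈ Finset.range L, (w - (i + 1 : ℕ)) :=
    Finset.prod_congr rfl fun i _ ↦ by push_cast; ring
  rw [binomCoeff, binomCoeff, Finset.prod_range_succ', h3, Nat.factorial_succ]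
  push_cast
  field_simp
  simp [mul_comm]

lemma binomCoeff_natCast (N L : ℕ) : binomCoeff N L = N.choose L := by
  induction L generalizing N with
  | zero => simp [binomCoeff]
  | succ L ih =>
    have h1 : ((L : ℂ) + 1) ≠ 0 := by exact_mod_cast L.succ_ne_zero
    rw [← mul_left_inj' h1, binomCoeff_succ]
    rcases N with _ | N
    · simp
    · have := ih N
      push_cast
      rw [add_sub_cancel_right, this]
      exact_mod_cast Nat.add_one_mul_choose_eq N L

lemma hasDerivAt_binomRemainder (K : ℕ) (w u : ℂ) (hu : 1 + u ∈ Complex.slitPlane) :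
    HasDerivAt (binomRemainder (K + 1) w) (w * binomRemainder K (w - 1) u) u := by
  have h1 : HasDerivAt (fun u : ℂ ↦ (1 + u) ^ w) (w * (1 + u) ^ (w - 1) * 1) u :=
    ((hasDerivAt_id u).const_add 1).cpow_const hu
  have h2 : HasDerivAt (fun u : ℂ ↦ ∑ L ∈ Finset.range (K + 1), binomCoeff w L * u ^ L)
      (∑ L ∈ Finset.range (K + 1), binomCoeff w L * (L * u ^ (L - 1))) u :=
    HasDerivAt.fun_sum fun L _ ↦ (hasDerivAt_pow L u).const_mul _
  refine (h1.sub h2).congr_deriv ?_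
  rw [binomRemainder, Finset.sum_range_succ', mul_sub, Finset.mul_sum]
  simp only [Nat.cast_zero, zero_mul, mul_zero, add_zero, mul_one, Nat.add_sub_cancel]
  congr 1
  refine Finset.sum_congr rfl fun L _ ↦ ?_
  rw [← mul_assoc w, ← binomCoeff_succ]
  push_cast
  ring

lemma exists_norm_binomRemainder_le (K : ℕ) (ρ B : ℝ) (hρ : 0 ≤ ρ) (hB : 0 ≤ B) :
    ∃ C : ℝ, 0 ≤ C ∧ ∀ (w : ℂ) (u : ℝ), ‖w‖ ≤ ρ → 0 ≤ u → u ≤ B →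
      ‖binomRemainder K w u‖ ≤ C * u ^ K := by
  induction K generalizing ρ with
  | zero =>
    refine ⟨(1 + B) ^ ρ, by positivity, fun w u hw hu huB ↦ ?_⟩
    have h : (0 : ℝ) < 1 + u := by linarith
    have h' : (1 : ℂ) + u = ((1 + u : ℝ) : ℂ) := by push_cast; rfl
    rw [binomRemainder, h', Finset.sum_range_zero, sub_zero,
      Complex.norm_cpow_eq_rpow_re_of_pos h, pow_zero, mul_one]
    calc (1 + u) ^ w.re ≤ (1 + u) ^ ρ :=
          Real.rpow_le_rpow_of_exponent_le (by linarith) ((Complex.re_le_norm w).trans hw)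
      _ ≤ _ := Real.rpow_le_rpow h.le (by linarith) hρ
  | succ K ih =>
    obtain ⟨C, hC, h⟩ := ih (ρ + 1) (by linarith)
    refine ⟨ρ * C, by positivity, fun w u hw hu huB ↦ ?_⟩
    have hz : binomRemainder (K + 1) w ((0 : ℝ) : ℂ) = 0 := by
      simp [binomRemainder, Finset.sum_range_succ', binomCoeff]
    have key := norm_image_sub_le_of_norm_deriv_le_segment' (a := 0) (b := u)
      (f := fun t : ℝ ↦ binomRemainder (K + 1) w t)
      (f' := fun t : ℝ ↦ w * binomRemainder K (w - 1) t) (C := ρ * (C * u ^ K))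
      (fun t ht ↦ by
        refine (HasDerivAt.comp_ofReal ?_).hasDerivWithinAt
        refine hasDerivAt_binomRemainder K w t (Or.inl ?_)
        have := ht.1
        simp only [Complex.add_re, Complex.one_re, Complex.ofReal_re]
        linarith)
      (fun t ht ↦ by
        rw [norm_mul]
        have h1 : ‖w - 1‖ ≤ ρ + 1 := (norm_sub_le _ _).trans (by simpa using hw)
        refine mul_le_mul hw ((h (w - 1) t h1 ht.1 (ht.2.le.trans huB)).trans ?_)
          (norm_nonneg _) hρ
        gcongr
        · exact ht.1
        · exact ht.2.le)
      u ⟨hu, le_rfl⟩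
    rw [hz, sub_zero, sub_zero] at key
    calc _ ≤ _ := key
      _ = _ := by ring

lemma binomRemainder_natCast_of_lt {N K : ℕ} (h : N < K) (u : ℂ) :
    binomRemainder K N u = 0 := by
  rw [binomRemainder, Complex.cpow_natCast, add_comm, add_pow, sub_eq_zero]
  refine (Finset.sum_subset (Finset.range_mono h) fun L _ hL ↦ ?_).trans
    (Finset.sum_congr rfl fun L _ ↦ ?_)
  · rw [Finset.mem_range, not_lt] at hL
    rw [Nat.choose_eq_zero_of_lt (by omega)]; simp
  · rw [binomCoeff_natCast]; ring

lemma differentiable_binomCoeff (L : ℕ) : Differentiable ℂ (fun w ↦ binomCoeff w L) := by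
  unfold binomCoeff
  fun_prop

lemma differentiable_binomRemainder (K : ℕ) {u : ℂ} (hu : 1 + u ≠ 0) :
    Differentiable ℂ (fun w ↦ binomRemainder K w u) := by
  unfold binomRemainder
  refine Differentiable.sub (fun w ↦ ?_) (Differentiable.fun_sum fun L _ ↦
    (differentiable_binomCoeff L).mul_const _)
  exact differentiableAt_id.const_cpow (Or.inl hu)

lemma exists_isOpen_isPreconnected_bounded {U : Set ℂ} (hUo : IsOpen U) (hUc : IsConnected U)
    {x p : ℂ} (hx : x ∈ U) (hp : p ∈ U) :
    ∃ (V : Set ℂ) (ρ : ℕ), IsOpen V ∧ IsPreconnected V ∧ x ∈ V ∧ p ∈ V ∧ V ⊆ U ∧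
      V ⊆ Metric.ball 0 ρ := by
  obtain ⟨γ, hγ⟩ := ((hUo.isConnected_iff_isPathConnected).1 hUc).joinedIn x hx p hp
  obtain ⟨r, hr⟩ := (isCompact_range γ.continuous).isBounded.subset_ball (0 : ℂ)
  obtain ⟨ρ, hρ⟩ := exists_nat_ge r
  have hsub : Set.range γ ⊆ U ∩ Metric.ball 0 ρ := by
    rintro _ ⟨t, rfl⟩
    exact ⟨hγ t, Metric.ball_subset_ball hρ (hr ⟨t, rfl⟩)⟩
  have hxr : x ∈ Set.range γ := ⟨0, γ.source⟩
  have hcomp := (isPreconnected_range γ.continuous).subset_connectedComponentIn hxr hsub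
  exact ⟨connectedComponentIn (U ∩ Metric.ball 0 ρ) x, ρ,
    (hUo.inter Metric.isOpen_ball).connectedComponentIn, isPreconnected_connectedComponentIn,
    hcomp hxr, hcomp ⟨1, γ.target⟩,
    (connectedComponentIn_subset _ _).trans Set.inter_subset_left,
    (connectedComponentIn_subset _ _).trans Set.inter_subset_right⟩

lemma eventuallyEq_nhdsNE_of_meromorphicOn {V : Set ℂ} (hVc : IsPreconnected V) {f g : ℂ → ℂ}
    (hf : MeromorphicOn f V) (hg : MeromorphicOn g V) {x p : ℂ} (hx : x ∈ V) (hp : p ∈ V)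
    (h : f =ᶠ[nhds p] g) : f =ᶠ[nhdsWithin x {x}ᶜ] g := by
  have hfg : MeromorphicOn (f - g) V := hf.sub hg
  have htop : meromorphicOrderAt (f - g) p = ⊤ := by
    rw [meromorphicOrderAt_eq_top_iff]
    filter_upwards [h.filter_mono nhdsWithin_le_nhds] with z hz
    simp [hz]
  have : meromorphicOrderAt (f - g) x = ⊤ := by
    by_contra hne
    exact hfg.meromorphicOrderAt_ne_top_of_isPreconnected hVc hx hp hne htop
  rw [meromorphicOrderAt_eq_top_iff] at this
  filter_upwards [this] with z hz
  exact sub_eq_zero.1 hz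

lemma tsum_eq_sum_piAntidiag {ι : Type*} [Fintype ι] [DecidableEq ι] (K : ℕ) (f : (ι → ℕ) → ℂ)
    (hf : ∀ k, K ≤ ∑ i, k i → f k = 0) :
    ∑' k, f k = ∑ L ∈ Finset.range K, ∑ k ∈ Finset.piAntidiag Finset.univ L, f k := by
  classical
  rw [← Finset.sum_biUnion, tsum_eq_sum]
  · intro k hk
    refine hf k (not_lt.1 fun hlt ↦ hk ?_)
    simpa [Finset.mem_biUnion, Finset.mem_piAntidiag] using hlt
  · intro L _ L' _ hne
    refine Finset.disjoint_left.2 fun k hk hk' ↦ hne ?_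
    rw [Finset.mem_piAntidiag] at hk hk'
    exact hk.1.symm.trans hk'.1

lemma zetaTerm_tendsto (A N L S : ℕ) (hA : 0 < A) (hL : S = 1 + A * N → N < L) :
    Filter.Tendsto (fun s : ℂ ↦ binomCoeff (-s) L * riemannZeta (A * s + S))
      (nhdsWithin (-(N : ℂ)) {-(N : ℂ)}ᶜ)
      (nhds (N.choose L * riemannZeta (-((A * N : ℕ) : ℂ) + S) +
        if S = 1 + A * N then
          (-1 : ℂ) ^ (L + N) * (L - N - 1).factorial * N.factorial / (A * L.factorial)
        else 0)) := by
  have hA' : (A : ℂ) ≠ 0 := by exact_mod_cast hA.ne'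
  split_ifs with hS
  · obtain ⟨r, rfl⟩ : ∃ r, L = N + 1 + r := ⟨L - (N + 1), by have := hL hS; omega⟩
    have hr : N + 1 + r - N - 1 = r := by omega
    rw [Nat.choose_eq_zero_of_lt (hL hS), hr]
    subst hS
    have hlim : Filter.Tendsto (fun s : ℂ ↦ (A : ℂ) * (s + N))
        (nhdsWithin (-(N : ℂ)) {-(N : ℂ)}ᶜ) (nhdsWithin 0 {0}ᶜ) := by
      refine tendsto_nhdsWithin_iff.2 ⟨?_, ?_⟩
      · have : ContinuousAt (fun s : ℂ ↦ (A : ℂ) * (s + N)) (-(N : ℂ)) := by fun_prop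
        have h := this.tendsto.mono_left (nhdsWithin_le_nhds (s := {-(N : ℂ)}ᶜ))
        simpa using h
      · filter_upwards [self_mem_nhdsWithin] with s hs
        exact mul_ne_zero hA' fun h ↦ hs (eq_neg_of_add_eq_zero_left h)
    have hlim1 : Filter.Tendsto (fun s : ℂ ↦ (A : ℂ) * s + ((1 + A * N : ℕ) : ℂ))
        (nhdsWithin (-(N : ℂ)) {-(N : ℂ)}ᶜ) (nhdsWithin 1 {1}ᶜ) := by
      refine tendsto_nhdsWithin_iff.2 ⟨?_, ?_⟩
      · have h := (tendsto_nhdsWithin_iff.1 hlim).1.const_add 1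
        rw [add_zero] at h
        refine h.congr fun s ↦ ?_
        push_cast
        ring
      · filter_upwards [(tendsto_nhdsWithin_iff.1 hlim).2] with s hs h
        refine hs ?_
        simp only [Set.mem_singleton_iff] at h ⊢
        push_cast at h
        linear_combination h
    have hzeta := riemannZeta_residue_one.comp hlim1
    have hpoly : ContinuousAt (fun s : ℂ ↦ -((∏ i ∈ Finset.range N, (-s - i)) *
        ∏ i ∈ Finset.range r, (-s - (N + 1 + i : ℕ))) / (A * (N + 1 + r).factorial))
        (-(N : ℂ)) := by fun_prop
    have hval : -((∏ i ∈ Finset.range N, (-(-(N : ℂ)) - i)) *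
        ∏ i ∈ Finset.range r, (-(-(N : ℂ)) - (N + 1 + i : ℕ))) =
        (-1 : ℂ) ^ (N + 1 + r + N) * r.factorial * N.factorial := by
      have h1 : ∏ i ∈ Finset.range N, (-(-(N : ℂ)) - i) = N.factorial := by
        have h := binomCoeff_natCast N N
        rw [Nat.choose_self, binomCoeff, div_eq_iff (by exact_mod_cast N.factorial_ne_zero)] at h
        simpa using h
      have h2 : ∏ i ∈ Finset.range r, (-(-(N : ℂ)) - (N + 1 + i : ℕ)) =
          (-1) ^ r * r.factorial := by
        rw [← Finset.prod_range_add_one_eq_factorial]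
        push_cast
        rw [← Finset.card_range r, ← Finset.prod_const, Finset.card_range,
          ← Finset.prod_mul_distrib]
        exact Finset.prod_congr rfl fun i _ ↦ by ring
      have h3 : (-1 : ℂ) ^ (N + 1 + r + N) = -(-1) ^ r := by
        rw [show N + 1 + r + N = 2 * N + 1 + r by ring, pow_add, pow_add, pow_mul]
        simp
      rw [h1, h2, h3]
      ring
    have h := (hpoly.tendsto.mono_left (nhdsWithin_le_nhds (s := {-(N : ℂ)}ᶜ))).mul hzeta
    rw [hval, mul_one] at h
    rw [Nat.cast_zero, zero_mul, zero_add]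
    refine h.congr' ?_
    filter_upwards [hlim.eventually self_mem_nhdsWithin] with s hs
    have hs' : (A : ℂ) * (s + N) ≠ 0 := hs
    have hfac : ((N + 1 + r).factorial : ℂ) ≠ 0 := by
      exact_mod_cast (N + 1 + r).factorial_ne_zero
    rw [binomCoeff, Finset.prod_range_add, Finset.prod_range_succ]
    simp only [Function.comp_apply]
    push_cast
    field_simp
    ring
  · have hne : (A : ℂ) * (-(N : ℂ)) + S ≠ 1 := fun h ↦ hS <| by
      have : (S : ℂ) = 1 + A * N := by linear_combination h
      exact_mod_cast this
    have h1 : ContinuousAt (fun s : ℂ ↦ binomCoeff (-s) L * riemannZeta (A * s + S))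
        (-(N : ℂ)) := by
      refine ContinuousAt.mul ?_ ?_
      · exact ((differentiable_binomCoeff L).continuous.comp continuous_neg).continuousAt
      · exact ContinuousAt.comp (f := fun s : ℂ ↦ (A : ℂ) * s + S)
          (differentiableAt_riemannZeta hne).continuousAt (by fun_prop)
    have h2 := h1.tendsto.mono_left (nhdsWithin_le_nhds (s := {-(N : ℂ)}ᶜ))
    rw [neg_neg, binomCoeff_natCast] at h2
    rw [add_zero]
    convert h2 using 3
    push_cast
    ring_nf

section Continuation

variable {ι : Type*} [Fintype ι]

/-- The value at `m + 1` of the polynomial `∑ j, b j * X⁻¹ ^ e j` in the inverse variable. -/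
noncomputable def invPolyVal (b : ι → ℝ) (e : ι → ℕ) (m : ℕ) : ℝ :=
  ∑ j, b j / ((m : ℝ) + 1) ^ e j

/-- The weight of the multi-index `l` in the multinomial expansion of a power of `∑ j, b j`. -/
noncomputable def multinomialTerm (b : ι → ℝ) (l : ι → ℕ) : ℂ :=
  Nat.multinomial Finset.univ l * ∏ j, (b j : ℂ) ^ l j

/-- The contribution of the remainders of order `K` of the binomial expansion. -/
noncomputable def zetaRemainderPart (b : ι → ℝ) (e : ι → ℕ) (A K : ℕ) (s : ℂ) : ℂ :=
  ∑' m : ℕ, ((m : ℂ) + 1) ^ (-(A * s)) * binomRemainder K (-s) (invPolyVal b e m)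

lemma invPolyVal_nonneg {b : ι → ℝ} (hb : ∀ j, 0 ≤ b j) (e : ι → ℕ) (m : ℕ) :
    0 ≤ invPolyVal b e m :=
  Finset.sum_nonneg fun j _ ↦ div_nonneg (hb j) (by positivity)

lemma invPolyVal_le {b : ι → ℝ} (hb : ∀ j, 0 ≤ b j) {e : ι → ℕ} (he : ∀ j, 1 ≤ e j) (m : ℕ) :
    invPolyVal b e m ≤ (∑ j, b j) / ((m : ℝ) + 1) := by
  rw [invPolyVal, Finset.sum_div]
  refine Finset.sum_le_sum fun j _ ↦ div_le_div_of_nonneg_left (hb j) (by positivity) ?_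
  exact le_self_pow₀ (by linarith [(Nat.cast_nonneg m : (0 : ℝ) ≤ m)]) (by have := he j; omega)

lemma one_add_invPolyVal_ne_zero {b : ι → ℝ} (hb : ∀ j, 0 ≤ b j) (e : ι → ℕ) (m : ℕ) :
    (1 : ℂ) + invPolyVal b e m ≠ 0 := by
  have := invPolyVal_nonneg hb e m
  exact_mod_cast (by linarith : (0 : ℝ) < 1 + invPolyVal b e m).ne'

lemma exists_summable_bound_remainder {b : ι → ℝ} (hb : ∀ j, 0 ≤ b j) {e : ι → ℕ}
    (he : ∀ j, 1 ≤ e j) {A K ρ : ℕ} (hK : A * ρ + 2 ≤ K) :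
    ∃ v : ℕ → ℝ, Summable v ∧ ∀ (m : ℕ), ∀ s ∈ Metric.ball (0 : ℂ) ρ,
      ‖((m : ℂ) + 1) ^ (-(A * s)) * binomRemainder K (-s) (invPolyVal b e m)‖ ≤ v m := by
  set B := ∑ j, b j
  have hB : 0 ≤ B := Finset.sum_nonneg fun j _ ↦ hb j
  obtain ⟨C, hC, hR⟩ := exists_norm_binomRemainder_le K ρ B (Nat.cast_nonneg ρ) hB
  refine ⟨fun m ↦ C * B ^ K * (1 / ((m : ℝ) + 1) ^ 2), ?_, fun m s hs ↦ ?_⟩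
  · refine Summable.mul_left _ ?_
    have := (summable_nat_add_iff 1).2 (Real.summable_one_div_nat_pow.2 one_lt_two)
    simpa using this
  · have hs' : ‖s‖ ≤ ρ := (mem_ball_zero_iff.1 hs).le
    have hm : (1 : ℝ) ≤ (m : ℝ) + 1 := by linarith [(Nat.cast_nonneg m : (0 : ℝ) ≤ m)]
    have hm0 : (0 : ℝ) < (m : ℝ) + 1 := by linarith
    have hu0 := invPolyVal_nonneg hb e m
    have hu := invPolyVal_le hb he m
    have huB : invPolyVal b e m ≤ B := hu.trans (div_le_self hB hm)
    have hpow : ‖((m : ℂ) + 1) ^ (-(A * s))‖ ≤ ((m : ℝ) + 1) ^ (A * ρ) := by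
      have hcast : (m : ℂ) + 1 = (((m : ℝ) + 1 : ℝ) : ℂ) := by push_cast; rfl
      rw [hcast, Complex.norm_cpow_eq_rpow_re_of_pos hm0, ← Real.rpow_natCast]
      refine Real.rpow_le_rpow_of_exponent_le hm ((Complex.re_le_norm _).trans ?_)
      rw [norm_neg, norm_mul, Complex.norm_natCast, Nat.cast_mul]
      gcongr
    rw [norm_mul]
    calc _ ≤ ((m : ℝ) + 1) ^ (A * ρ) * (C * (B / ((m : ℝ) + 1)) ^ K) := by
          refine mul_le_mul hpow ((hR (-s) _ (by simpa using hs') hu0 huB).trans ?_)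
            (norm_nonneg _) (by positivity)
          gcongr
      _ = C * B ^ K * (((m : ℝ) + 1) ^ (A * ρ) / ((m : ℝ) + 1) ^ K) := by
          rw [div_pow]; ring
      _ ≤ C * B ^ K * (1 / ((m : ℝ) + 1) ^ 2) := by
          refine mul_le_mul_of_nonneg_left ?_ (by positivity)
          rw [div_le_div_iff₀ (by positivity) (by positivity), one_mul, ← pow_add]
          exact pow_le_pow_right₀ hm hK

lemma differentiableOn_zetaRemainderPart {b : ι → ℝ} (hb : ∀ j, 0 ≤ b j) {e : ι → ℕ}
    (he : ∀ j, 1 ≤ e j) {A K ρ : ℕ} (hK : A * ρ + 2 ≤ K) :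
    DifferentiableOn ℂ (zetaRemainderPart b e A K) (Metric.ball 0 ρ) := by
  obtain ⟨v, hv, hle⟩ := exists_summable_bound_remainder hb he hK
  refine Complex.differentiableOn_tsum_of_summable_norm hv (fun m ↦ ?_) Metric.isOpen_ball hle
  refine Differentiable.differentiableOn (Differentiable.mul (fun s ↦ ?_) ?_)
  · refine DifferentiableAt.const_cpow (by fun_prop) (Or.inl ?_)
    exact_mod_cast m.succ_ne_zero
  · exact (differentiable_binomRemainder K (one_add_invPolyVal_ne_zero hb e m)).comp
      differentiable_neg

lemma zetaRemainderPart_neg_natCast (b : ι → ℝ) (e : ι → ℕ) (A : ℕ) {N K : ℕ} (h : N < K) :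
    zetaRemainderPart b e A K (-N) = 0 := by
  simp [zetaRemainderPart, binomRemainder_natCast_of_lt h]

variable [DecidableEq ι]

/-- The contribution of the first `K` terms of the binomial expansion. -/
noncomputable def zetaMainPart (b : ι → ℝ) (e : ι → ℕ) (A K : ℕ) (s : ℂ) : ℂ :=
  ∑ L ∈ Finset.range K, ∑ l ∈ Finset.piAntidiag Finset.univ L,
    multinomialTerm b l * (binomCoeff (-s) L * riemannZeta (A * s + (∑ j, e j * l j : ℕ)))

lemma meromorphic_zetaMainPart (b : ι → ℝ) (e : ι → ℕ) (A K : ℕ) (hA : 0 < A) (s : ℂ) :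
    MeromorphicAt (zetaMainPart b e A K) s := by
  have hA' : (A : ℂ) ≠ 0 := by exact_mod_cast hA.ne'
  unfold zetaMainPart
  refine MeromorphicAt.fun_sum fun L _ ↦ MeromorphicAt.fun_sum fun l _ ↦ ?_
  refine (MeromorphicAt.const _ _).fun_mul (MeromorphicAt.fun_mul ?_ ?_)
  · exact (((differentiable_binomCoeff L).comp differentiable_neg).analyticAt s).meromorphicAt
  · refine (meromorphic_riemannZeta _).comp_analyticAt (g := fun s : ℂ ↦ A * s + _) ?_
    fun_prop

lemma hasSum_zeta_shift {z : ℂ} (hz : 1 < z.re) :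
    HasSum (fun m : ℕ ↦ ((m : ℂ) + 1) ^ (-z)) (riemannZeta z) := by
  have h : Summable fun m : ℕ ↦ ((m : ℂ) + 1) ^ (-z) := by
    have := (summable_nat_add_iff 1).2 (Complex.summable_one_div_nat_cpow.2 hz)
    simpa [Complex.cpow_neg] using this
  have h2 := h.hasSum
  rw [zeta_eq_tsum_one_div_nat_add_one_cpow hz]
  simpa [Complex.cpow_neg] using h2

lemma hasSum_expansion {b : ι → ℝ} (hb : ∀ j, 0 ≤ b j) {e : ι → ℕ}
    (he : ∀ j, 1 ≤ e j) {A K ρ : ℕ} (hK : A * ρ + 2 ≤ K) {s : ℂ} (hs : s ∈ Metric.ball (0 : ℂ) ρ)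
    (hs1 : 1 < A * s.re) :
    HasSum (fun m : ℕ ↦ ((m : ℂ) + 1) ^ (-(A * s)) * ((1 : ℂ) + invPolyVal b e m) ^ (-s))
      (zetaMainPart b e A K s + zetaRemainderPart b e A K s) := by
  obtain ⟨v, hv, hle⟩ := exists_summable_bound_remainder hb he hK
  have hR : HasSum (fun m : ℕ ↦ ((m : ℂ) + 1) ^ (-(A * s)) *
      binomRemainder K (-s) (invPolyVal b e m)) (zetaRemainderPart b e A K s) :=
    (Summable.of_norm_bounded hv fun m ↦ hle m s hs).hasSum
  have hM : HasSum (fun m : ℕ ↦ ∑ L ∈ Finset.range K, ∑ l ∈ Finset.piAntidiag Finset.univ L,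
      multinomialTerm b l * (binomCoeff (-s) L *
        ((m : ℂ) + 1) ^ (-(A * s + (∑ j, e j * l j : ℕ))))) (zetaMainPart b e A K s) := by
    refine hasSum_sum fun L _ ↦ hasSum_sum fun l _ ↦ ((hasSum_zeta_shift ?_).mul_left _).mul_left _
    have : (0 : ℝ) ≤ (∑ j, e j * l j : ℕ) := Nat.cast_nonneg _
    simp only [Complex.add_re, Complex.mul_re, Complex.natCast_re, Complex.natCast_im, zero_mul,
      sub_zero]
    linarith
  convert hM.add hR using 2 with m
  have hm : (m : ℂ) + 1 ≠ 0 := by exact_mod_cast m.succ_ne_zero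
  have hu : ∀ L, ((invPolyVal b e m : ℝ) : ℂ) ^ L = ∑ l ∈ Finset.piAntidiag Finset.univ L,
      multinomialTerm b l * (((m : ℂ) + 1) ^ (∑ j, e j * l j))⁻¹ := fun L ↦ by
    rw [invPolyVal]
    push_cast
    rw [Finset.sum_pow_eq_sum_piAntidiag]
    refine Finset.sum_congr rfl fun l _ ↦ ?_
    simp only [multinomialTerm, mul_assoc, div_pow, Finset.prod_div_distrib, ← pow_mul,
      Finset.prod_pow_eq_pow_sum]
    rw [div_eq_mul_inv]
  have hmain : ∑ L ∈ Finset.range K, ∑ l ∈ Finset.piAntidiag Finset.univ L,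
      multinomialTerm b l * (binomCoeff (-s) L *
        ((m : ℂ) + 1) ^ (-(A * s + (∑ j, e j * l j : ℕ)))) =
      ((m : ℂ) + 1) ^ (-(A * s)) *
        ∑ L ∈ Finset.range K, binomCoeff (-s) L * ((invPolyVal b e m : ℝ) : ℂ) ^ L := by
    simp only [hu, Finset.mul_sum]
    refine Finset.sum_congr rfl fun L _ ↦ Finset.sum_congr rfl fun l _ ↦ ?_
    rw [neg_add, Complex.cpow_add _ _ hm, Complex.cpow_neg _ ((∑ j, e j * l j : ℕ) : ℂ),
      Complex.cpow_natCast]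
    ring
  rw [hmain, binomRemainder]
  ring

lemma zetaMainPart_tendsto (b : ι → ℝ) {e : ι → ℕ} {A : ℕ} (N K : ℕ) (hA : 0 < A)
    (heA : ∀ j, e j ≤ A) :
    Filter.Tendsto (zetaMainPart b e A K) (nhdsWithin (-(N : ℂ)) {-(N : ℂ)}ᶜ)
      (nhds (∑ L ∈ Finset.range K, ∑ l ∈ Finset.piAntidiag Finset.univ L, multinomialTerm b l *
        (N.choose L * riemannZeta (-((A * N : ℕ) : ℂ) + (∑ j, e j * l j : ℕ)) +
        if ∑ j, e j * l j = 1 + A * N then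
          (-1 : ℂ) ^ (L + N) * (L - N - 1).factorial * N.factorial / (A * L.factorial)
        else 0))) := by
  refine tendsto_finsetSum _ fun L _ ↦ tendsto_finsetSum _ fun l hl ↦
    (zetaTerm_tendsto A N L _ hA fun h ↦ ?_).const_mul _
  have h1 : ∑ j, e j * l j ≤ A * L := by
    rw [← (Finset.mem_piAntidiag.1 hl).1, Finset.mul_sum]
    exact Finset.sum_le_sum fun j _ ↦ Nat.mul_le_mul_right _ (heA j)
  by_contra hLN
  have := Nat.mul_le_mul_left A (not_lt.1 hLN)
  omega

theorem exists_forall_continuation_eq {b : ι → ℝ} (hb : ∀ j, 0 ≤ b j) {e : ι → ℕ}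
    (he : ∀ j, 1 ≤ e j) {A : ℕ} (hA : 0 < A) (heA : ∀ j, e j ≤ A) {c : ℝ} (hc : 0 < c) (N : ℕ)
    {U : Set ℂ} {Z : ℂ → ℂ} (hUo : IsOpen U) (hUc : IsConnected U) (hNU : -(N : ℂ) ∈ U)
    (hZ : DifferentiableOn ℂ Z U) {σ : ℝ} (hσU : {z : ℂ | σ < z.re} ⊆ U)
    (hsum : ∀ z : ℂ, σ < z.re → Z z = ∑' m : ℕ,
      (c : ℂ) ^ (-z) * (((m : ℂ) + 1) ^ (-(A * z)) * ((1 : ℂ) + invPolyVal b e m) ^ (-z))) :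
    ∃ K₀, ∀ K, K₀ ≤ K → Z (-(N : ℂ)) = (c : ℂ) ^ N *
      ∑ L ∈ Finset.range K, ∑ l ∈ Finset.piAntidiag Finset.univ L, multinomialTerm b l *
        (N.choose L * riemannZeta (-((A * N : ℕ) : ℂ) + (∑ j, e j * l j : ℕ)) +
        if ∑ j, e j * l j = 1 + A * N then
          (-1 : ℂ) ^ (L + N) * (L - N - 1).factorial * N.factorial / (A * L.factorial)
        else 0) := by
  have hp : ((|σ| + 2 : ℝ) : ℂ) ∈ {z : ℂ | σ < z.re} := by
    simp only [Set.mem_ofPred_eq, Complex.ofReal_re]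
    linarith [le_abs_self σ]
  obtain ⟨V, ρ, hVo, hVc, hxV, hpV, hVU, hVρ⟩ :=
    exists_isOpen_isPreconnected_bounded hUo hUc hNU (hσU hp)
  refine ⟨max (A * ρ + 2) (N + 1), fun K hK ↦ ?_⟩
  have hK1 : A * ρ + 2 ≤ K := (le_max_left _ _).trans hK
  have hK2 : N < K := (le_max_right _ _).trans hK
  have hc0 : (c : ℂ) ≠ 0 := by exact_mod_cast hc.ne'
  have hcpow : Differentiable ℂ fun s : ℂ ↦ (c : ℂ) ^ (-s) := fun s ↦
    DifferentiableAt.const_cpow (by fun_prop) (Or.inl hc0)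
  have hrem := (differentiableOn_zetaRemainderPart hb he hK1).analyticOnNhd Metric.isOpen_ball
  have hmer : MeromorphicOn
      (fun s ↦ (c : ℂ) ^ (-s) * (zetaMainPart b e A K s + zetaRemainderPart b e A K s)) V := by
    intro s hs
    exact (hcpow.analyticAt s).meromorphicAt.fun_mul
      ((meromorphic_zetaMainPart b e A K hA s).fun_add (hrem s (hVρ hs)).meromorphicAt)
  have hloc : Z =ᶠ[nhds ((|σ| + 2 : ℝ) : ℂ)] (fun s ↦ (c : ℂ) ^ (-s) *
      (zetaMainPart b e A K s + zetaRemainderPart b e A K s)) := by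
    have hopen : IsOpen {z : ℂ | |σ| + 1 < z.re} := isOpen_lt continuous_const Complex.continuous_re
    filter_upwards [hVo.mem_nhds hpV, hopen.mem_nhds
      (show |σ| + 1 < (((|σ| + 2 : ℝ) : ℂ)).re by rw [Complex.ofReal_re]; linarith)] with z hzV hz
    have hz' : |σ| + 1 < z.re := hz
    have hA1 : (1 : ℝ) ≤ A := by exact_mod_cast hA
    rw [hsum z (by linarith [le_abs_self σ])]
    refine HasSum.tsum_eq (HasSum.mul_left _ (hasSum_expansion hb he hK1 (hVρ hzV) ?_))
    nlinarith [abs_nonneg σ]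
  have hev := eventuallyEq_nhdsNE_of_meromorphicOn hVc
    (fun s hs ↦ ((hZ.analyticOnNhd hUo) s (hVU hs)).meromorphicAt) hmer hxV hpV hloc
  have hZlim : Filter.Tendsto Z (nhdsWithin (-(N : ℂ)) {-(N : ℂ)}ᶜ) (nhds (Z (-(N : ℂ)))) :=
    (hZ.differentiableAt (hUo.mem_nhds hNU)).continuousAt.tendsto.mono_left nhdsWithin_le_nhds
  have hremlim := (hrem _ (hVρ hxV)).continuousAt.tendsto.mono_left
    (nhdsWithin_le_nhds (s := {-(N : ℂ)}ᶜ))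
  rw [zetaRemainderPart_neg_natCast b e A hK2] at hremlim
  have hclim := (hcpow (-(N : ℂ))).continuousAt.tendsto.mono_left
    (nhdsWithin_le_nhds (s := {-(N : ℂ)}ᶜ))
  rw [neg_neg, Complex.cpow_natCast] at hclim
  have hlim := hclim.mul ((zetaMainPart_tendsto b N K hA heA).add hremlim)
  rw [add_zero] at hlim
  exact tendsto_nhds_unique (hZlim.congr' hev) hlim

/-- The linear functional on polynomials sending `X ^ n` to `ζ(-n)`. -/
noncomputable def zetaFunctional : Polynomial ℂ →ₗ[ℂ] ℂ :=
  (Polynomial.basisMonomials ℂ).constr ℂ fun n ↦ riemannZeta (-(n : ℂ))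

lemma zetaFunctional_X_pow (n : ℕ) :
    zetaFunctional ((Polynomial.X : Polynomial ℂ) ^ n) = riemannZeta (-(n : ℂ)) := by
  rw [Polynomial.X_pow_eq_monomial]
  exact (Polynomial.basisMonomials ℂ).constr_basis ℂ (fun n : ℕ ↦ riemannZeta (-(n : ℂ))) n

lemma zetaFunctional_pow (b : ι → ℝ) (f : ι → ℕ) (A N : ℕ) :
    zetaFunctional ((Polynomial.X ^ A +
      ∑ j, Polynomial.C (b j : ℂ) * Polynomial.X ^ f j) ^ N) =
    ∑ L ∈ Finset.range (N + 1), ∑ l ∈ Finset.piAntidiag Finset.univ L,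
      multinomialTerm b l * (N.choose L *
        riemannZeta (-((A * (N - L) + ∑ j, f j * l j : ℕ) : ℂ))) := by
  rw [add_comm, add_pow, map_sum]
  refine Finset.sum_congr rfl fun L _ ↦ ?_
  rw [Finset.sum_pow_eq_sum_piAntidiag, Finset.sum_mul, Finset.sum_mul, map_sum]
  refine Finset.sum_congr rfl fun l _ ↦ ?_
  rw [← zetaFunctional_X_pow, ← smul_eq_mul (N.choose L : ℂ), ← map_smul,
    ← smul_eq_mul (multinomialTerm b l), ← map_smul]
  congr 1
  simp only [Polynomial.smul_eq_C_mul, multinomialTerm, mul_pow, Finset.prod_mul_distrib,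
    ← pow_mul, Finset.prod_pow_eq_pow_sum, pow_add, map_mul, map_prod, map_pow, map_natCast]
  ring

end Continuation

lemma sum_zeta_eq_zetaFunctional {ι : Type*} [Fintype ι] [DecidableEq ι] (b : ι → ℝ)
    (f : ι → ℕ) {A : ℕ} (hf : ∀ j, f j ≤ A) {N K : ℕ} (hK : N < K) :
    ∑ L ∈ Finset.range K, ∑ l ∈ Finset.piAntidiag Finset.univ L, multinomialTerm b l *
        (N.choose L * riemannZeta (-((A * N : ℕ) : ℂ) + (∑ j, (A - f j) * l j : ℕ))) =
      zetaFunctional ((Polynomial.X ^ A +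
        ∑ j, Polynomial.C (b j : ℂ) * Polynomial.X ^ f j) ^ N) := by
  rw [zetaFunctional_pow]
  symm
  refine (Finset.sum_congr rfl fun L hL ↦ Finset.sum_congr rfl fun l hl ↦ ?_).trans
    (Finset.sum_subset (Finset.range_mono hK) fun L _ hL ↦ ?_)
  · have hLN : L ≤ N := Nat.lt_succ_iff.1 (Finset.mem_range.1 hL)
    have hl' : ∑ j, l j = L := (Finset.mem_piAntidiag.1 hl).1
    have h1 : ∑ j, (A - f j) * l j + ∑ j, f j * l j = A * L := by
      rw [← Finset.sum_add_distrib, ← hl', Finset.mul_sum]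
      refine Finset.sum_congr rfl fun j _ ↦ ?_
      rw [← add_mul, Nat.sub_add_cancel (hf j)]
    have h2 : A * (N - L) + A * L = A * N := by rw [← mul_add, Nat.sub_add_cancel hLN]
    have h3 : A * (N - L) + ∑ j, f j * l j + ∑ j, (A - f j) * l j = A * N := by omega
    rw [← h3]
    congr 3
    push_cast
    ring
  · refine Finset.sum_eq_zero fun l _ ↦ ?_
    rw [Nat.choose_eq_zero_of_lt (by simpa using hL)]
    simp

lemma tsum_bernoulli_eq_neg_zetaFunctional {ι : Type*} [Fintype ι] [DecidableEq ι] (b : ι → ℝ)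
    (f : ι → ℕ) {A : ℕ} (hf : ∀ j, A ≤ f j) (N : ℕ) :
    (∑' k : ι → ℕ, if (∑ i, k i) ≤ N then
        ((N.factorial : ℂ) / ((∏ i, ((k i).factorial : ℂ)) *
          (((N - ∑ i, k i).factorial : ℕ) : ℂ))) *
          ((-1 : ℂ) ^ (A * N + (∑ i, (f i - A) * k i) + 1) *
            ((bernoulli (A * N + (∑ i, (f i - A) * k i) + 1) : ℚ) : ℂ) /
            ((A * N + (∑ i, (f i - A) * k i) + 1 : ℕ) : ℂ)) *
          ∏ i, ((b i : ℝ) : ℂ) ^ (k i)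
      else 0) =
    -zetaFunctional ((Polynomial.X ^ A +
        ∑ j, Polynomial.C (b j : ℂ) * Polynomial.X ^ f j) ^ N) := by
  rw [zetaFunctional_pow, tsum_eq_sum_piAntidiag (N + 1), ← Finset.sum_neg_distrib]
  swap
  · intro k hk
    rw [if_neg (by omega)]
  refine Finset.sum_congr rfl fun L hL ↦ ?_
  rw [← Finset.sum_neg_distrib]
  refine Finset.sum_congr rfl fun k hk ↦ ?_
  have hLN : L ≤ N := Nat.lt_succ_iff.1 (Finset.mem_range.1 hL)
  have hk' : ∑ j, k j = L := (Finset.mem_piAntidiag.1 hk).1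
  have h1 : ∑ j, (f j - A) * k j + A * L = ∑ j, f j * k j := by
    rw [← hk', Finset.mul_sum, ← Finset.sum_add_distrib]
    refine Finset.sum_congr rfl fun j _ ↦ ?_
    rw [← add_mul, Nat.sub_add_cancel (hf j)]
  have h2 : A * (N - L) + A * L = A * N := by rw [← mul_add, Nat.sub_add_cancel hLN]
  have h3 : A * (N - L) + ∑ j, f j * k j = A * N + ∑ j, (f j - A) * k j := by omega
  have hM : ((∏ i, ((k i).factorial : ℂ)) * Nat.multinomial Finset.univ k) =
      (L.factorial : ℂ) := by
    have := Nat.multinomial_spec Finset.univ k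
    rw [hk'] at this
    exact_mod_cast this
  have hC : (N.choose L : ℂ) * L.factorial * (N - L).factorial = N.factorial := by
    exact_mod_cast Nat.choose_mul_factorial_mul_factorial hLN
  have hp : (∏ i, ((k i).factorial : ℂ)) ≠ 0 :=
    Finset.prod_ne_zero_iff.2 fun i _ ↦ by exact_mod_cast (k i).factorial_ne_zero
  have hq : ((N - L).factorial : ℂ) ≠ 0 := by exact_mod_cast (N - L).factorial_ne_zero
  have hr : (N.factorial : ℂ) / ((∏ i, ((k i).factorial : ℂ)) * ((N - L).factorial : ℂ)) =
      N.choose L * Nat.multinomial Finset.univ k := by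
    rw [div_eq_iff (mul_ne_zero hp hq), ← hC, ← hM]
    ring
  rw [hk', if_pos hLN, h3, riemannZeta_neg_nat_eq_bernoulli, hr, multinomialTerm]
  push_cast
  ring

lemma sum_residue_eq_tsum {D : ℕ} (c₀ : ℝ) {γ : ℝ} (hγ : 0 < γ) (b : Fin D → ℝ) (e₀ : ℕ)
    (e : Fin D → ℕ) (he₀ : 0 < e₀) (he : ∀ j, 0 < e j) {A N K : ℕ} (hK : 1 + A * N < K) :
    (γ : ℂ) ^ N * ∑ L ∈ Finset.range K, ∑ l ∈ Finset.piAntidiag Finset.univ L,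
      multinomialTerm (Fin.cons (c₀ / γ) b : Fin (D + 1) → ℝ) l *
        (if ∑ j, (Fin.cons e₀ e : Fin (D + 1) → ℕ) j * l j = 1 + A * N then
          (-1 : ℂ) ^ (L + N) * (L - N - 1).factorial * N.factorial / (A * L.factorial)
        else 0) =
    ∑' pl : ℕ × (Fin D → ℕ),
      if pl.1 ≤ (A * N + 1) / e₀ ∧ (∑ j, e j * pl.2 j) + pl.1 * e₀ = 1 + A * N then
        (((-1 : ℂ) ^ ((∑ j, pl.2 j) + pl.1 + N) *
            (((((∑ j, pl.2 j) + pl.1 - N - 1).factorial : ℕ)) : ℂ) *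
            (N.factorial : ℂ)) /
            ((A : ℂ) * (pl.1.factorial : ℂ) * ∏ j, ((pl.2 j).factorial : ℂ))) *
          ((c₀ : ℝ) : ℂ) ^ pl.1 * ((γ : ℝ) : ℂ) ^ ((N : ℤ) - (pl.1 : ℤ)) *
          ∏ j, ((b j : ℝ) : ℂ) ^ (pl.2 j)
      else 0 := by
  have hγ0 : (γ : ℂ) ≠ 0 := by exact_mod_cast hγ.ne'
  have hsum := tsum_eq_sum_piAntidiag K (fun l : Fin (D + 1) → ℕ ↦
    multinomialTerm (Fin.cons (c₀ / γ) b : Fin (D + 1) → ℝ) l *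
      (if ∑ j, (Fin.cons e₀ e : Fin (D + 1) → ℕ) j * l j = 1 + A * N then
        (-1 : ℂ) ^ ((∑ j, l j) + N) * ((∑ j, l j) - N - 1).factorial * N.factorial /
          (A * (∑ j, l j).factorial)
      else 0)) (fun l hl ↦ by
    refine mul_eq_zero_of_right _ (if_neg fun h ↦ ?_)
    have : ∑ j, l j ≤ ∑ j, (Fin.cons e₀ e : Fin (D + 1) → ℕ) j * l j := by
      refine Finset.sum_le_sum fun j _ ↦ Nat.le_mul_of_pos_left _ ?_
      refine Fin.cases ?_ (fun j ↦ ?_) j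
      · simpa using he₀
      · simpa using he j
    omega)
  have hleft : ∑ L ∈ Finset.range K, ∑ l ∈ Finset.piAntidiag Finset.univ L,
      multinomialTerm (Fin.cons (c₀ / γ) b : Fin (D + 1) → ℝ) l *
        (if ∑ j, (Fin.cons e₀ e : Fin (D + 1) → ℕ) j * l j = 1 + A * N then
          (-1 : ℂ) ^ (L + N) * (L - N - 1).factorial * N.factorial / (A * L.factorial)
        else 0) = ∑ L ∈ Finset.range K, ∑ l ∈ Finset.piAntidiag Finset.univ L,
      multinomialTerm (Fin.cons (c₀ / γ) b : Fin (D + 1) → ℝ) l *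
      (if ∑ j, (Fin.cons e₀ e : Fin (D + 1) → ℕ) j * l j = 1 + A * N then
        (-1 : ℂ) ^ ((∑ j, l j) + N) * ((∑ j, l j) - N - 1).factorial * N.factorial /
          (A * (∑ j, l j).factorial)
      else 0) := by
    refine Finset.sum_congr rfl fun L _ ↦ Finset.sum_congr rfl fun l hl ↦ ?_
    have hl' : ∑ j, l j = L := (Finset.mem_piAntidiag.1 hl).1
    rw [hl']
  rw [hleft, ← hsum, ← tsum_mul_left, ← (Fin.consEquiv fun _ : Fin (D + 1) ↦ ℕ).tsum_eq]
  refine tsum_congr fun ⟨i, l⟩ ↦ ?_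
  have hcond : (i ≤ (A * N + 1) / e₀ ∧ (∑ j, e j * l j) + i * e₀ = 1 + A * N) ↔
      e₀ * i + ∑ j, e j * l j = 1 + A * N := by
    rw [Nat.le_div_iff_mul_le he₀, mul_comm e₀ i]
    omega
  have hcons : (Fin.consEquiv fun _ : Fin (D + 1) ↦ ℕ) (i, l) = Fin.cons i l := rfl
  simp only [hcons, Fin.sum_univ_succ, Fin.cons_zero, Fin.cons_succ, hcond]
  split_ifs with h
  · have hM := Nat.multinomial_spec Finset.univ (Fin.cons i l : Fin (D + 1) → ℕ)
    simp only [Fin.sum_univ_succ, Fin.prod_univ_succ, Fin.cons_zero, Fin.cons_succ] at hM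
    have hM' : (i.factorial : ℂ) * (∏ j, ((l j).factorial : ℂ)) *
        Nat.multinomial Finset.univ (Fin.cons i l : Fin (D + 1) → ℕ) =
        ((i + ∑ j, l j).factorial : ℂ) := by exact_mod_cast hM
    have hp : (∏ j, ((l j).factorial : ℂ)) ≠ 0 :=
      Finset.prod_ne_zero_iff.2 fun j _ ↦ by exact_mod_cast (l j).factorial_ne_zero
    have hi : (i.factorial : ℂ) ≠ 0 := by exact_mod_cast i.factorial_ne_zero
    have hL : ((i + ∑ j, l j).factorial : ℂ) ≠ 0 := by exact_mod_cast Nat.factorial_ne_zero _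
    have hm : (Nat.multinomial Finset.univ (Fin.cons i l : Fin (D + 1) → ℕ) : ℂ) ≠ 0 := fun h ↦
      hL (by rw [← hM', h, mul_zero])
    simp only [multinomialTerm, Fin.prod_univ_succ, Fin.cons_zero, Fin.cons_succ]
    rw [← hM', zpow_sub₀ hγ0, zpow_natCast, zpow_natCast, add_comm (∑ j, l j) i]
    push_cast
    rcases eq_or_ne (A : ℂ) 0 with hA | hA
    · simp [hA]
    · rw [div_pow]
      field_simp
  · simp

lemma strictMono_upTo {a : ℕ → ℕ} {d : ℕ} (ha : ∀ i, i < d → a i < a (i + 1)) {i j : ℕ}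
    (hij : i < j) (hj : j ≤ d) : a i < a j := by
  induction j, hij using Nat.le_induction with
  | base => exact ha i hj
  | succ j hij ih => exact (ih (by omega)).trans (ha j hj)

lemma polynomial_value_eq {d : ℕ} {c : ℕ → ℝ} {a : ℕ → ℕ} (hcd : 0 < c d)
    (ha : ∀ j, j < d → a j ≤ a d) (m : ℕ) :
    ∑ j ∈ Finset.range (d + 1), c j * ((m : ℝ) + 1) ^ a j = c d * (((m : ℝ) + 1) ^ a d *
      (1 + invPolyVal (fun j : Fin d ↦ c j / c d) (fun j ↦ a d - a j) m)) := by
  have hm : ((m : ℝ) + 1) ≠ 0 := by positivity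
  rw [Finset.sum_range_succ, Finset.sum_range, invPolyVal, mul_add, mul_add, mul_one, add_comm,
    Finset.mul_sum, Finset.mul_sum]
  congr 1
  refine Finset.sum_congr rfl fun j _ ↦ ?_
  have h : ((m : ℝ) + 1) ^ a d = ((m : ℝ) + 1) ^ a j * ((m : ℝ) + 1) ^ (a d - a j) := by
    rw [← pow_add, Nat.add_sub_cancel' (ha j j.2)]
  rw [h]
  field_simp

lemma polynomial_value_cpow {d : ℕ} {c : ℕ → ℝ} {a : ℕ → ℕ} (hc : ∀ j, j ≤ d → 0 < c j)
    (ha : ∀ j, j < d → a j ≤ a d) (m : ℕ) (z : ℂ) :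
    ((∑ j ∈ Finset.range (d + 1), c j * ((m : ℝ) + 1) ^ a j : ℝ) : ℂ) ^ (-z) =
      ((c d : ℝ) : ℂ) ^ (-z) * (((m : ℂ) + 1) ^ (-((a d : ℕ) * z)) *
        ((1 : ℂ) + invPolyVal (fun j : Fin d ↦ c j / c d) (fun j ↦ a d - a j) m) ^ (-z)) := by
  have hu := invPolyVal_nonneg (b := fun j : Fin d ↦ c j / c d)
    (fun j ↦ (div_pos (hc j j.2.le) (hc d le_rfl)).le) (fun j ↦ a d - a j) m
  rw [polynomial_value_eq (hc d le_rfl) ha, Complex.ofReal_mul,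
    Complex.mul_cpow_ofReal_nonneg (hc d le_rfl).le (by positivity), Complex.ofReal_mul,
    Complex.mul_cpow_ofReal_nonneg (by positivity) (by positivity)]
  congr 2
  · have h : (((m : ℝ) + 1 : ℝ) : ℂ) = (m : ℂ) + 1 := by push_cast; rfl
    have h2 := Complex.natCast_cpow_natCast_mul (m + 1) (a d) (-z)
    rw [Nat.cast_add_one] at h2
    rw [Complex.ofReal_pow, h, ← h2, mul_neg]
  · push_cast; rfl

lemma zetaFunctional_factor_top_eq_bot {d : ℕ} {c : ℕ → ℝ} (a : ℕ → ℕ) (hc0 : c 0 ≠ 0)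
    (hcd : c d ≠ 0) (N : ℕ) :
    ((c d : ℝ) : ℂ) ^ N * zetaFunctional ((Polynomial.X ^ a d +
        ∑ j : Fin d, Polynomial.C ((c j / c d : ℝ) : ℂ) * Polynomial.X ^ a j) ^ N) =
    ((c 0 : ℝ) : ℂ) ^ N * zetaFunctional ((Polynomial.X ^ a 0 +
        ∑ j : Fin d, Polynomial.C ((c (j + 1) / c 0 : ℝ) : ℂ) *
          Polynomial.X ^ a (j + 1)) ^ N) := by
  have key : ∀ γ : ℝ, γ ≠ 0 → ∀ x : ℝ, Polynomial.C (γ : ℂ) * Polynomial.C ((x / γ : ℝ) : ℂ) =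
      Polynomial.C (x : ℂ) := fun γ hγ x ↦ by
    rw [← Polynomial.C_mul, ← Complex.ofReal_mul, mul_div_cancel₀ _ hγ]
  rw [← smul_eq_mul, ← smul_eq_mul, ← map_smul, ← map_smul, Polynomial.smul_eq_C_mul,
    Polynomial.smul_eq_C_mul, Polynomial.C_pow, Polynomial.C_pow, ← mul_pow, ← mul_pow]
  congr 2
  rw [mul_add, mul_add, Finset.mul_sum, Finset.mul_sum]
  simp only [← mul_assoc, key _ hc0, key _ hcd]
  rw [Finset.sum_range (fun j ↦ Polynomial.C ((c j : ℝ) : ℂ) * Polynomial.X ^ a j) |>.symm,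
    Finset.sum_range (fun j ↦ Polynomial.C ((c (j + 1) : ℝ) : ℂ) * Polynomial.X ^ a (j + 1))
      |>.symm, add_comm, ← Finset.sum_range_succ, Finset.sum_range_succ', add_comm]


/-- the case `n = T = 1`: explicit value at `−N` of the continuation of
`ζ_1(s) = Σ_{m≥1} P(m)^{−s}` for `P(X) = c_0 X^{a_0} + … + c_d X^{a_d}`, where
`bernoulli` has `B_1 = −1/2` (so `B̃_m = (−1)^m B_m`). -/
theorem stmt_18 (d : ℕ) (hd : 1 ≤ d) (c : ℕ → ℝ) (a : ℕ → ℕ)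
    (hc : ∀ j, j ≤ d → 0 < c j) (ha : ∀ i, i < d → a i < a (i + 1))
    (Nn : ℕ) (U : Set ℂ) (Z : ℂ → ℂ) (hUopen : IsOpen U) (hUconn : IsConnected U)
    (hNU : -(Nn : ℂ) ∈ U) (hZ : DifferentiableOn ℂ Z U)
    (hser : ∃ σ : ℝ, {z : ℂ | σ < z.re} ⊆ U ∧ ∀ z : ℂ, σ < z.re →
      Summable (fun m : ℕ =>
        ((∑ j ∈ Finset.range (d + 1), c j * ((m : ℝ) + 1) ^ (a j) : ℝ) : ℂ) ^ (-z)) ∧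
      Z z = ∑' m : ℕ,
        ((∑ j ∈ Finset.range (d + 1), c j * ((m : ℝ) + 1) ^ (a j) : ℝ) : ℂ) ^ (-z)) :
    Z (-(Nn : ℂ)) =
      -(((c 0 : ℝ) : ℂ) ^ Nn *
        ∑' k : Fin d → ℕ, if (∑ i : Fin d, k i) ≤ Nn then
          ((Nn.factorial : ℂ) /
              ((∏ i : Fin d, ((k i).factorial : ℂ)) *
                (((Nn - ∑ i : Fin d, k i).factorial : ℕ) : ℂ))) *
            ((-1 : ℂ) ^ (a 0 * Nn + (∑ i : Fin d, (a ((i : ℕ) + 1) - a 0) * k i) + 1) *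
                ((bernoulli
                    (a 0 * Nn + (∑ i : Fin d, (a ((i : ℕ) + 1) - a 0) * k i) + 1) : ℚ) : ℂ) /
                ((a 0 * Nn + (∑ i : Fin d, (a ((i : ℕ) + 1) - a 0) * k i) + 1 : ℕ) : ℂ)) *
            ∏ i : Fin d, ((c ((i : ℕ) + 1) / c 0 : ℝ) : ℂ) ^ (k i)
        else 0) +
      ∑' pl : ℕ × (Fin (d - 1) → ℕ),
        if pl.1 ≤ (a d * Nn + 1) / (a d - a 0) ∧
            (∑ j : Fin (d - 1), (a d - a ((j : ℕ) + 1)) * pl.2 j) +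
              pl.1 * (a d - a 0) = 1 + a d * Nn then
          (((-1 : ℂ) ^ ((∑ j : Fin (d - 1), pl.2 j) + pl.1 + Nn) *
              (((((∑ j : Fin (d - 1), pl.2 j) + pl.1 - Nn - 1).factorial : ℕ)) : ℂ) *
              (Nn.factorial : ℂ)) /
              ((a d : ℂ) * (pl.1.factorial : ℂ) * ∏ j : Fin (d - 1), ((pl.2 j).factorial : ℂ))) *
            ((c 0 : ℝ) : ℂ) ^ pl.1 * ((c d : ℝ) : ℂ) ^ ((Nn : ℤ) - (pl.1 : ℤ)) *
            ∏ j : Fin (d - 1), ((c ((j : ℕ) + 1) / c d : ℝ) : ℂ) ^ (pl.2 j)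
        else 0 := by
  obtain ⟨D, rfl⟩ : ∃ D, d = D + 1 := ⟨d - 1, by omega⟩
  obtain ⟨σ, hσU, hser⟩ := hser
  have hmono : ∀ i j, i < j → j ≤ D + 1 → a i < a j := fun i j ↦ strictMono_upTo ha
  have hcd := hc (D + 1) le_rfl
  have hc0 := hc 0 (Nat.zero_le _)
  have hle : ∀ j, j < D + 1 → a j ≤ a (D + 1) := fun j hj ↦ (hmono j _ hj le_rfl).le
  obtain ⟨K₀, hval⟩ := exists_forall_continuation_eq
    (b := fun j : Fin (D + 1) ↦ c j / c (D + 1)) (e := fun j ↦ a (D + 1) - a j)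
    (A := a (D + 1)) (c := c (D + 1)) (fun j ↦ (div_pos (hc j j.2.le) hcd).le)
    (fun j ↦ by have := hmono j _ j.2 le_rfl; omega)
    (by have := hmono 0 (D + 1) (by omega) le_rfl; omega) (fun j ↦ Nat.sub_le _ _) hcd Nn
    hUopen hUconn hNU hZ hσU
    (fun z hz ↦ ((hser z hz).2).trans (tsum_congr fun m ↦ polynomial_value_cpow hc hle m z))
  have hK := hval (K₀ + (Nn + 1) + (2 + a (D + 1) * Nn)) (by omega)
  simp only [mul_add, Finset.sum_add_distrib] at hK
  rw [hK]
  congr 1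
  · rw [sum_zeta_eq_zetaFunctional (fun j : Fin (D + 1) ↦ c j / c (D + 1)) (fun j ↦ a j)
      (fun j ↦ hle j j.2) (by omega), zetaFunctional_factor_top_eq_bot a hc0.ne' hcd.ne',
      tsum_bernoulli_eq_neg_zetaFunctional (fun i : Fin (D + 1) ↦ c ((i : ℕ) + 1) / c 0)
        (fun i ↦ a ((i : ℕ) + 1)) (fun j ↦ (hmono 0 _ (by omega) (by omega)).le)]
    ring
  · have h := sum_residue_eq_tsum (c 0) hcd (fun j : Fin D ↦ c ((j : ℕ) + 1) / c (D + 1))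
      (a (D + 1) - a 0) (fun j ↦ a (D + 1) - a ((j : ℕ) + 1))
      (by have := hmono 0 (D + 1) (by omega) le_rfl; omega)
      (fun j ↦ by have := hmono ((j : ℕ) + 1) (D + 1) (by omega) le_rfl; omega)
      (A := a (D + 1)) (N := Nn) (K := K₀ + (Nn + 1) + (2 + a (D + 1) * Nn)) (by omega)
    have hb : (Fin.cons (c 0 / c (D + 1)) (fun j : Fin D ↦ c ((j : ℕ) + 1) / c (D + 1)) :
        Fin (D + 1) → ℝ) = fun j : Fin (D + 1) ↦ c j / c (D + 1) := by
      funext j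
      refine Fin.cases ?_ (fun j ↦ ?_) j <;> simp
    have he : (Fin.cons (a (D + 1) - a 0) (fun j : Fin D ↦ a (D + 1) - a ((j : ℕ) + 1)) :
        Fin (D + 1) → ℕ) = fun j : Fin (D + 1) ↦ a (D + 1) - a j := by
      funext j
      refine Fin.cases ?_ (fun j ↦ ?_) j <;> simp
    rw [hb, he] at h
    exact h
end

section
/- Let q be a positive even integer and N = (N_1,N_2) ∈ ℕ₀². Consider the double series ζ_2(s_1,s_2) := Σ_{m_1,m_2 ≥ 1} (−1)^{m_1}·(1 + m_2 + m_1^q m_2^2)^{−s_2} (i.e. the partially twisted series with P_1(X_1) = 1, P_2(X_1,X_2) = 1 + X_2 + X_1^q X_2², and twist μ_1 = −1), which converges absolutely for Re s_2 sufficiently large (uniformly in s_1). Let Z be any holomorphic function on an open connected set U ⊆ ℂ² containing (−N_1,−N_2) and some nonempty open set on which the series converges absolutely, with Z equal to the series there (such (U,Z) exist and all give the same value). Then the complex number Z(−N_1,−N_2) is transcendental over ℚ. -/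
open Polynomial in
theorem aroots_map_algHom {K L : Type*} [Field K] [Algebra ℚ K] [IsAlgClosed K]
    [Field L] [Algebra ℚ L] (p : ℚ[X]) (g : K →ₐ[ℚ] L) :
    (p.aroots K).map g = p.aroots L := by
  have h := (IsAlgClosed.splits (p.map (algebraMap ℚ K))).roots_map (g : K →+* L)
  rw [aroots_def, aroots_def]
  conv_rhs => rw [← g.comp_algebraMap, ← Polynomial.map_map]
  exact h.symm

open Polynomial in
theorem sum_aroots_mem_range {K : Type*} [Field K] [Algebra ℚ K] [IsAlgClosed K] [IsGalois ℚ K]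
    (p g : ℚ[X]) :
    ((p.aroots K).map (fun r => aeval r g)).sum ∈ Set.range (algebraMap ℚ K) := by
  rw [InfiniteGalois.mem_range_algebraMap_iff_fixed]
  intro f
  conv_rhs => rw [← aroots_map_algHom p (f : K →ₐ[ℚ] K)]
  rw [map_multiset_sum, Multiset.map_map, Multiset.map_map]
  congr 2
  ext r
  exact (aeval_algHom_apply (f : K →ₐ[ℚ] K) r g).symm

theorem Multiset.map_sum_powerset_map {F K L : Type*} [AddCommMonoid K] [AddCommMonoid L]
    [FunLike F K L] [AddMonoidHomClass F K L] (g : F) (s : Multiset K) :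
    (s.map g).powerset.map Multiset.sum = (s.powerset.map Multiset.sum).map g := by
  induction s using Multiset.induction_on with
  | empty => simp
  | cons a s ih =>
    have h := congrArg (Multiset.map (fun x => g a + x)) ih
    simp only [Multiset.map_map, Function.comp_def] at ih h
    simp [ih, h, map_add]

open Polynomial in
theorem prod_X_sub_sum_powerset_mem_lifts {K : Type*} [Field K] [Algebra ℚ K] [IsAlgClosed K]
    [IsGalois ℚ K] (p : ℚ[X]) :
    (((p.aroots K).powerset.map Multiset.sum).map (fun a => X - C a)).prod
      ∈ lifts (algebraMap ℚ K) := by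
  rw [lifts_iff_coeff_lifts]
  intro n
  rw [InfiniteGalois.mem_range_algebraMap_iff_fixed]
  intro f
  have h := Polynomial.map_multiset_prod (f : K →+* K)
    (((p.aroots K).powerset.map Multiset.sum).map (fun a => X - C a))
  rw [Multiset.map_map (fun p : K[X] => p.map (f : K →+* K))] at h
  have h2 := Multiset.map_sum_powerset_map (f : K →ₐ[ℚ] K) (p.aroots K)
  rw [aroots_map_algHom] at h2
  conv_rhs => rw [h2, Multiset.map_map]
  refine (Polynomial.coeff_map (f : K →+* K) n).symm.trans ?_
  rw [h]
  congr 3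
  ext1 r
  simp

theorem exists_isGalois_isAlgClosed_algHom (F L : Type) [Field F] [CharZero F] [Field L]
    [Algebra F L] [IsAlgClosed L] :
    ∃ (K : Type) (_ : Field K) (_ : Algebra F K) (_ : IsAlgClosed K) (_ : IsGalois F K),
      Nonempty (K →ₐ[F] L) :=
  ⟨algebraicClosure F L, inferInstance, inferInstance, IsAlgClosure.isAlgClosed F,
    inferInstance, ⟨(algebraicClosure F L).val⟩⟩

open Polynomial in
theorem exists_rat_eq_sum_aroots (p g : ℚ[X]) :
    ∃ c : ℚ, ((p.aroots ℂ).map (fun r => aeval r g)).sum = (c : ℂ) := by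
  obtain ⟨K, _, _, _, _, ⟨ι⟩⟩ := exists_isGalois_isAlgClosed_algHom ℚ ℂ
  obtain ⟨c, hc⟩ := sum_aroots_mem_range (K := K) p g
  refine ⟨c, ?_⟩
  have := congrArg ι hc
  rw [AlgHom.commutes, map_multiset_sum, Multiset.map_map] at this
  rw [← aroots_map_algHom p ι, Multiset.map_map, ← eq_ratCast (algebraMap ℚ ℂ), this]
  congr 2
  ext1 r
  exact aeval_algHom_apply ι r g

open Polynomial in
theorem exists_aroots_eq_map_sum_powerset (p : ℚ[X]) :
    ∃ Q : ℚ[X], Q ≠ 0 ∧ Q.aroots ℂ = (p.aroots ℂ).powerset.map Multiset.sum := by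
  obtain ⟨K, _, _, _, _, ⟨ι⟩⟩ := exists_isGalois_isAlgClosed_algHom ℚ ℂ
  have hm := monic_multiset_prod_of_monic
    ((p.aroots K).powerset.map Multiset.sum) _ fun a _ => monic_X_sub_C a
  obtain ⟨Q, hQ⟩ := (mem_lifts _).1
    (prod_X_sub_sum_powerset_mem_lifts (K := K) p)
  refine ⟨Q, ?_, ?_⟩
  · rintro rfl
    rw [Polynomial.map_zero] at hQ
    exact hm.ne_zero hQ.symm
  · rw [← aroots_map_algHom Q ι, ← aroots_map_algHom p ι, aroots_def, hQ,
      roots_multiset_prod_X_sub_C, Multiset.map_sum_powerset_map]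

theorem prod_map_one_add_exp (s : Multiset ℂ) :
    (s.map (fun r => 1 + Complex.exp r)).prod
      = ((s.powerset.map Multiset.sum).map Complex.exp).sum := by
  induction s using Multiset.induction_on with
  | empty => simp
  | cons a s ih =>
    simp only [Multiset.map_cons, Multiset.prod_cons, ih, Multiset.powerset_cons,
      Multiset.map_add, Multiset.sum_add, Multiset.map_map, Function.comp_def,
      Multiset.sum_cons, Complex.exp_add, Multiset.sum_map_mul_left]
    ring

open Polynomial in
theorem exists_int_eq_leadingCoeff_pow_mul_sum (f g : ℤ[X]) (d : ℕ) (hd : g.natDegree ≤ d) :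
    ∃ m : ℤ, (f.leadingCoeff : ℂ) ^ d * ((f.aroots ℂ).map (fun r => aeval r g)).sum = m := by
  obtain ⟨c, hc⟩ := exists_rat_eq_sum_aroots (f.map (algebraMap ℤ ℚ)) (g.map (algebraMap ℤ ℚ))
  simp only [aeval_map_algebraMap, aroots_map] at hc
  rw [← Multiset.sum_map_mul_left]
  have hint : IsIntegral ℤ
      ((f.aroots ℂ).map (fun r => (f.leadingCoeff : ℂ) ^ d * aeval r g)).sum := by
    refine IsIntegral.multiset_sum fun x hx => ?_
    obtain ⟨r, hr, rfl⟩ := Multiset.mem_map.1 hx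
    have hr' : IsIntegral ℤ ((f.leadingCoeff : ℂ) * r) := by
      have := isIntegral_leadingCoeff_smul f r (aeval_eq_zero_of_mem_rootSet (by simpa [rootSet_def] using hr))
      simpa using this
    rw [aeval_eq_sum_range' (Nat.lt_succ_of_le hd), Finset.mul_sum]
    refine IsIntegral.sum _ fun i hi => ?_
    have hi' : i ≤ d := Nat.lt_succ_iff.1 (Finset.mem_range.1 hi)
    have : (f.leadingCoeff : ℂ) ^ d * (g.coeff i • r ^ i)
        = ((f.leadingCoeff ^ (d - i) * g.coeff i : ℤ) : ℂ) * ((f.leadingCoeff : ℂ) * r) ^ i := by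
      rw [zsmul_eq_mul, mul_pow, ← pow_sub_mul_pow _ hi']
      push_cast
      ring
    rw [this]
    exact (isIntegral_algebraMap (R := ℤ) (A := ℂ)).mul (hr'.pow i)
  have hq : IsIntegral ℤ ((f.leadingCoeff : ℚ) ^ d * c) := by
    rw [← isIntegral_algebraMap_iff (algebraMap ℚ ℂ).injective (R := ℤ)]
    rw [Multiset.sum_map_mul_left, hc] at hint
    simpa using hint
  obtain ⟨m, hm⟩ := IsIntegrallyClosed.isIntegral_iff.1 hq
  refine ⟨m, ?_⟩
  rw [Multiset.sum_map_mul_left, hc]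
  have := congrArg (algebraMap ℚ ℂ) hm
  simp at this
  exact this.symm

open Polynomial in
theorem sum_exp_aroots_ne_neg_natCast (f : ℤ[X]) (hf : f.eval 0 ≠ 0) (k : ℕ) (hk : k ≠ 0) :
    ((f.aroots ℂ).map Complex.exp).sum ≠ -(k : ℂ) := by
  intro h
  obtain ⟨c, hc⟩ := LindemannWeierstrass.exp_polynomial_approx f hf
  have hf0 : f ≠ 0 := by rintro rfl; simp at hf
  set a := f.leadingCoeff with ha
  have ha0 : a ≠ 0 := leadingCoeff_ne_zero.2 hf0
  set D := f.natDegree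
  set S := (f.aroots ℂ).card
  -- the approximations, summed over the roots and cleared of denominators, are integers
  have key : ∀ p > max (f.eval 0).natAbs (max k a.natAbs), p.Prime →
      1 ≤ (S : ℝ) * ((|(a : ℝ)| ^ D * |c|) ^ p / ((p - 1).factorial : ℝ)) := by
    intro p hp hpp
    obtain ⟨n, hn, g, hg, happ⟩ := hc p (lt_of_le_of_lt (le_max_left _ _) hp) hpp
    obtain ⟨m, hm⟩ := exists_int_eq_leadingCoeff_pow_mul_sum f g (p * D)
      (hg.trans (Nat.sub_le _ _))
    have hsum : ‖((f.aroots ℂ).map fun r => n • Complex.exp r - p • aeval r g).sum‖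
        ≤ S * (|c| ^ p / ((p - 1).factorial : ℝ)) := by
      refine (norm_multiset_sum_le _).trans ?_
      rw [Multiset.map_map]
      refine (Multiset.sum_le_card_nsmul _ (|c| ^ p / ((p - 1).factorial : ℝ)) ?_).trans ?_
      · intro x hx
        obtain ⟨r, hr, rfl⟩ := Multiset.mem_map.1 hx
        refine (happ hr).trans ?_
        exact div_le_div_of_nonneg_right ((le_abs_self _).trans (abs_pow _ _).le) (by positivity)
      · simp [S]
    have heq : ((a ^ (p * D) * n * k + p * m : ℤ) : ℂ) = -((a : ℂ) ^ (p * D) *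
        ((f.aroots ℂ).map fun r => n • Complex.exp r - p • aeval r g).sum) := by
      simp only [zsmul_eq_mul, nsmul_eq_mul]
      rw [Multiset.sum_map_sub, Multiset.sum_map_mul_left, Multiset.sum_map_mul_left, h]
      push_cast
      rw [← hm]
      ring
    have hne : a ^ (p * D) * n * k + p * m ≠ 0 := by
      intro h0
      have hd : (p : ℤ) ∣ a ^ (p * D) * n * k :=
        (Int.dvd_add_left (dvd_mul_right _ _)).1 (h0 ▸ dvd_zero _)
      have hpi := Nat.prime_iff_prime_int.1 hpp
      rcases hpi.dvd_or_dvd hd with h1 | h1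
      · rcases hpi.dvd_or_dvd h1 with h2 | h2
        · have h3 := Int.natAbs_dvd_natAbs.2 (hpi.dvd_of_dvd_pow h2)
          have := Nat.le_of_dvd (Int.natAbs_pos.2 ha0) h3
          simp only [Int.natAbs_natCast] at this
          omega
        · exact hn h2
      · have := Nat.le_of_dvd (Nat.pos_of_ne_zero hk) (Int.natCast_dvd_natCast.1 h1)
        omega
    have h1 : (1 : ℝ) ≤ ‖((a ^ (p * D) * n * k + p * m : ℤ) : ℂ)‖ := by
      rw [Complex.norm_intCast]
      exact_mod_cast Int.one_le_abs hne
    refine h1.trans ?_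
    rw [heq, norm_neg, norm_mul, norm_pow, Complex.norm_intCast]
    refine (mul_le_mul_of_nonneg_left hsum (by positivity)).trans (le_of_eq ?_)
    rw [mul_pow, ← pow_mul, mul_comm D p]
    ring
  have hlim : Filter.Tendsto (fun p : ℕ => (S : ℝ) * ((|(a : ℝ)| ^ D * |c|) *
      ((|(a : ℝ)| ^ D * |c|) ^ p / (p.factorial : ℝ)))) Filter.atTop (nhds 0) := by
    simpa using ((FloorSemiring.tendsto_pow_div_factorial_atTop
      (|(a : ℝ)| ^ D * |c|)).const_mul (|(a : ℝ)| ^ D * |c|)).const_mul (S : ℝ)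
  obtain ⟨P, hP⟩ := Filter.eventually_atTop.1 (hlim.eventually (gt_mem_nhds zero_lt_one))
  obtain ⟨p, hp, hpp⟩ := Nat.exists_infinite_primes
    (max (f.eval 0).natAbs (max k a.natAbs) + P + 2)
  have h1 := key p (by omega) hpp
  have h2 := hP (p - 1) (by omega)
  rw [← mul_div_assoc, ← pow_succ', Nat.sub_add_cancel hpp.one_le] at h2
  linarith

open Polynomial in
theorem exists_int_aroots_eq_of_rat (R : ℚ[X]) (hR : R.eval 0 ≠ 0) :
    ∃ f : ℤ[X], f.eval 0 ≠ 0 ∧ f.aroots ℂ = R.aroots ℂ := by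
  obtain ⟨b, hb, h⟩ := IsLocalization.integerNormalization_spec (nonZeroDivisors ℤ) R
  have hb0 : (b : ℚ) ≠ 0 := by exact_mod_cast nonZeroDivisors.ne_zero hb
  have h' : (IsLocalization.integerNormalization (nonZeroDivisors ℤ) R).map (algebraMap ℤ ℚ)
      = C (b : ℚ) * R := by
    rw [h, ← smul_eq_C_mul]
    exact (Int.cast_smul_eq_zsmul ℚ b R).symm
  refine ⟨IsLocalization.integerNormalization (nonZeroDivisors ℤ) R, ?_, ?_⟩
  · intro h0
    have := congrArg (Polynomial.eval 0) h'
    rw [eval_map, eval₂_at_zero] at this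
    rw [← coeff_zero_eq_eval_zero] at h0
    rw [h0] at this
    simp [hb0, hR] at this
  · rw [← aroots_map ℂ ℚ, h', aroots_C_mul _ hb0]

/-- `π` is transcendental. -/
theorem transcendental_pi : Transcendental ℚ (Real.pi : ℂ) := by
  intro halg
  have hI : IsAlgebraic ℚ (Real.pi * Complex.I : ℂ) := by
    refine halg.mul ?_
    refine ⟨Polynomial.X ^ 2 + 1, ?_, by simp⟩
    exact (Polynomial.monic_X_pow_add_C (R := ℚ) 1 two_ne_zero).ne_zero
  obtain ⟨p, hp0, hp⟩ := hI
  obtain ⟨Q, hQ0, hQ⟩ := exists_aroots_eq_map_sum_powerset p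
  have hprod : ((p.aroots ℂ).map (fun r => 1 + Complex.exp r)).prod = 0 := by
    rw [Multiset.prod_eq_zero_iff, Multiset.mem_map]
    exact ⟨Real.pi * Complex.I, (Polynomial.mem_aroots.2 ⟨hp0, hp⟩), by simp [Complex.exp_pi_mul_I]⟩
  rw [prod_map_one_add_exp, ← hQ] at hprod
  obtain ⟨R, hR, hRd⟩ := Polynomial.exists_eq_pow_rootMultiplicity_mul_and_not_dvd Q hQ0 0
  set k := Q.rootMultiplicity 0
  rw [Polynomial.C_0, sub_zero] at hR hRd
  have hR0 : R.eval 0 ≠ 0 := by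
    rwa [Polynomial.X_dvd_iff, Polynomial.coeff_zero_eq_eval_zero] at hRd
  have hk : k ≠ 0 := by
    rw [← Nat.pos_iff_ne_zero, Polynomial.rootMultiplicity_pos hQ0]
    have : (0 : ℂ) ∈ Q.aroots ℂ := by
      rw [hQ, Multiset.mem_map]
      exact ⟨0, by simp⟩
    have h := (Polynomial.mem_aroots.1 this).2
    rw [← map_zero (algebraMap ℚ ℂ), Polynomial.aeval_algebraMap_apply] at h
    simpa using h
  have hne : Polynomial.X ^ k * R ≠ 0 := hR ▸ hQ0
  rw [hR, Polynomial.aroots_mul hne, Polynomial.aroots_X_pow, Multiset.map_add,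
    Multiset.sum_add] at hprod
  obtain ⟨f, hf, hfR⟩ := exists_int_aroots_eq_of_rat R hR0
  refine sum_exp_aroots_ne_neg_natCast f hf k hk ?_
  rw [hfR]
  simp only [Multiset.map_nsmul, Multiset.map_singleton, Complex.exp_zero, Multiset.sum_nsmul,
    Multiset.sum_singleton, nsmul_eq_mul, mul_one] at hprod
  linear_combination hprod
open Finset in
/-- The binomial coefficient `-s` choose `k`, as a function of `s`. -/
noncomputable def binomNeg (k : ℕ) (s : ℂ) : ℂ := (∏ i ∈ range k, (-s - i)) / k.factorial

open Finset in
/-- The remainder of order `M` of the binomial series of `(1 + x) ^ (-s)`. -/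
noncomputable def binomRem (M : ℕ) (s : ℂ) (x : ℝ) : ℂ :=
  ((1 + x : ℝ) : ℂ) ^ (-s) - ∑ k ∈ range M, binomNeg k s * (x : ℂ) ^ k

@[simp]
theorem binomNeg_zero (s : ℂ) : binomNeg 0 s = 1 := by simp [binomNeg]

theorem succ_mul_binomNeg_succ (k : ℕ) (s : ℂ) :
    ((k : ℂ) + 1) * binomNeg (k + 1) s = -s * binomNeg k (s + 1) := by
  have h1 : (k : ℂ) + 1 ≠ 0 := by exact_mod_cast k.succ_ne_zero
  have h2 : (k.factorial : ℂ) ≠ 0 := by exact_mod_cast k.factorial_ne_zero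
  rw [binomNeg, binomNeg, Finset.prod_range_succ', Nat.factorial_succ]
  push_cast
  rw [show (∏ i ∈ Finset.range k, (-s - ((i : ℂ) + 1))) = ∏ i ∈ Finset.range k, (-(s + 1) - (i : ℂ))
    from Finset.prod_congr rfl fun i _ => by ring]
  field_simp
  ring

theorem differentiable_binomNeg (k : ℕ) : Differentiable ℂ (binomNeg k) := by
  unfold binomNeg
  fun_prop

theorem binomNeg_neg_natCast (k N : ℕ) : binomNeg k (-(N : ℂ)) = (N.choose k : ℂ) := by
  rw [binomNeg, Nat.cast_choose_eq_descPochhammer_div, descPochhammer_eval_eq_prod_range]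
  simp

theorem binomNeg_neg_natCast_of_lt {k N : ℕ} (h : N < k) : binomNeg k (-(N : ℂ)) = 0 := by
  rw [binomNeg_neg_natCast, Nat.choose_eq_zero_of_lt h, Nat.cast_zero]

theorem exists_hasDerivAt_binomNeg {k N : ℕ} (h : N < k) :
    ∃ c : ℚ, c ≠ 0 ∧ HasDerivAt (binomNeg k) (c : ℂ) (-(N : ℂ)) := by
  refine ⟨-(∏ i ∈ (Finset.range k).erase N, ((N : ℚ) - i)) / k.factorial, ?_, ?_⟩
  · refine div_ne_zero (neg_ne_zero.2 (Finset.prod_ne_zero_iff.2 fun i hi => ?_))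
      (by exact_mod_cast k.factorial_ne_zero)
    rw [sub_ne_zero]
    exact_mod_cast (Finset.ne_of_mem_erase hi).symm
  · have h1 : ∀ i ∈ Finset.range k, HasDerivAt (fun s : ℂ => -s - (i : ℂ)) (-1) (-(N : ℂ)) :=
      fun i _ => (hasDerivAt_neg _).sub_const _
    have h2 := (HasDerivAt.fun_finsetProd h1).div_const (k.factorial : ℂ)
    rw [Finset.sum_eq_single_of_mem N (Finset.mem_range.2 h)] at h2
    · unfold binomNeg
      refine h2.congr_deriv ?_
      push_cast
      simp
    · intro j _ hjN
      rw [Finset.prod_eq_zero (i := N)] <;> simp [h, hjN.symm]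

theorem binomRem_neg_natCast {M N : ℕ} (h : N < M) (x : ℝ) : binomRem M (-(N : ℂ)) x = 0 := by
  rw [binomRem, neg_neg, Complex.cpow_natCast, sub_eq_zero]
  push_cast
  rw [add_comm, add_pow, eq_comm]
  rw [← Finset.sum_subset (Finset.range_subset_range.2 (Nat.succ_le_of_lt h))]
  · refine Finset.sum_congr rfl fun k _ => ?_
    rw [binomNeg_neg_natCast]
    ring
  · intro k _ hk
    rw [binomNeg_neg_natCast_of_lt (by simpa using hk), zero_mul]

theorem hasDerivAt_binomRem (M : ℕ) (s : ℂ) {x : ℝ} (hx : 0 ≤ x) :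
    HasDerivAt (binomRem (M + 1) s) (-s * binomRem M (s + 1) x) x := by
  have h1 : HasDerivAt (fun t : ℝ => ((1 + t : ℝ) : ℂ) ^ (-s))
      (-s * ((1 + x : ℝ) : ℂ) ^ (-(s + 1))) x := by
    have h := ((hasDerivAt_id' (x : ℂ)).const_add 1).cpow_const (c := -s)
      (Or.inl (by simp; linarith))
    have h' := h.comp_ofReal
    push_cast
    refine h'.congr_deriv ?_
    rw [show -(s + 1) = -s - 1 by ring]
    simp
  have h2 : HasDerivAt (fun t : ℝ => ∑ k ∈ Finset.range (M + 1), binomNeg k s * (t : ℂ) ^ k)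
      (∑ k ∈ Finset.range M, -s * (binomNeg k (s + 1) * (x : ℂ) ^ k)) x := by
    have h : ∀ k ∈ Finset.range (M + 1), HasDerivAt (fun t : ℝ => binomNeg k s * (t : ℂ) ^ k)
        (binomNeg k s * (k * (x : ℂ) ^ (k - 1))) x := fun k _ => by
      simpa using (((hasDerivAt_id' x).ofReal_comp).pow k).const_mul (binomNeg k s)
    refine (HasDerivAt.fun_sum h).congr_deriv ?_
    rw [Finset.sum_range_succ']
    simp only [Nat.cast_zero, zero_mul, mul_zero, add_zero, Nat.add_sub_cancel]
    refine Finset.sum_congr rfl fun k _ => ?_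
    push_cast
    linear_combination (x : ℂ) ^ k * succ_mul_binomNeg_succ k s
  refine (h1.sub h2).congr_deriv ?_
  rw [binomRem, ← Finset.mul_sum]
  ring

theorem exists_norm_binomRem_le (M : ℕ) (B : ℝ) :
    ∃ C : ℝ, 0 ≤ C ∧ ∀ s : ℂ, ‖s‖ ≤ B → ∀ x ∈ Set.Icc (0 : ℝ) 2, ‖binomRem M s x‖ ≤ C * x ^ M := by
  induction M generalizing B with
  | zero =>
    refine ⟨3 ^ |B|, by positivity, fun s hs x hx => ?_⟩
    have h1 : (1 : ℝ) ≤ 1 + x := by linarith [hx.1]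
    simp only [binomRem, Finset.range_zero, Finset.sum_empty, sub_zero, pow_zero, mul_one]
    rw [Complex.norm_cpow_eq_rpow_re_of_pos (by linarith)]
    refine (Real.rpow_le_rpow_of_exponent_le h1 (y := (-s).re) (z := |B|) ?_).trans ?_
    · exact (Complex.re_le_norm _).trans (by rw [norm_neg]; exact hs.trans (le_abs_self _))
    · exact Real.rpow_le_rpow (by linarith) (by linarith [hx.2]) (abs_nonneg _)
  | succ M ih =>
    obtain ⟨C, hC0, hC⟩ := ih (B + 1)
    refine ⟨|B| * C, by positivity, fun s hs x hx => ?_⟩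
    have hB : ‖s‖ ≤ |B| := hs.trans (le_abs_self _)
    have h0 : binomRem (M + 1) s 0 = 0 := by
      simp [binomRem, Finset.sum_range_succ']
    have h := (convex_Icc (0 : ℝ) x).norm_image_sub_le_of_norm_hasDerivWithin_le
      (f := binomRem (M + 1) s) (f' := fun t => -s * binomRem M (s + 1) t) (C := |B| * (C * x ^ M))
      (fun t ht => (hasDerivAt_binomRem M s ht.1).hasDerivWithinAt)
      (fun t ht => ?_) (Set.left_mem_Icc.2 hx.1) (Set.right_mem_Icc.2 hx.1)
    · rw [h0, sub_zero, sub_zero, Real.norm_of_nonneg hx.1] at h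
      refine h.trans (le_of_eq ?_)
      ring
    · rw [norm_mul, norm_neg]
      refine mul_le_mul hB ?_ (norm_nonneg _) (abs_nonneg _)
      refine (hC (s + 1) ?_ t ⟨ht.1, ht.2.trans hx.2⟩).trans ?_
      · exact (norm_add_le _ _).trans (by simpa using hs)
      · exact mul_le_mul_of_nonneg_left (pow_le_pow_left₀ ht.1 ht.2 _) hC0

theorem differentiable_binomRem (M : ℕ) {x : ℝ} (hx : 0 ≤ x) :
    Differentiable ℂ (fun s => binomRem M s x) := by
  have h : ((1 + x : ℝ) : ℂ) ≠ 0 := by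
    exact_mod_cast (by linarith : (1 + x) ≠ 0)
  have := differentiable_binomNeg
  unfold binomRem
  refine Differentiable.sub (fun s => ?_) (by fun_prop)
  exact (differentiable_neg s).const_cpow (Or.inl h)

theorem exists_differentiable_mul_riemannZeta {A : ℂ → ℂ} (hA : Differentiable ℂ A) {s₀ : ℂ}
    (h0 : A s₀ = 0) :
    ∃ B : ℂ → ℂ, Differentiable ℂ B ∧ B s₀ = deriv A s₀ / 2 ∧
      ∀ s, s ≠ s₀ → B s = A s * riemannZeta (2 * (s - s₀) + 1) := by
  classical
  set F : ℂ → ℂ := fun s => A s * riemannZeta (2 * (s - s₀) + 1) with hF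
  have hne : ∀ s, s ≠ s₀ → 2 * (s - s₀) + 1 ≠ 1 := by
    intro s hs h
    apply hs
    linear_combination h / 2
  have hFd : ∀ s, s ≠ s₀ → DifferentiableAt ℂ F s := fun s hs => by
    have h1 := differentiableAt_riemannZeta (hne s hs)
    have h2 : DifferentiableAt ℂ (fun s => 2 * (s - s₀) + 1) s := by fun_prop
    exact (hA s).mul (h1.comp s h2)
  have hcongr : ∀ s, s ≠ s₀ → Function.update F s₀ (deriv A s₀ / 2) =ᶠ[nhds s] F := fun s hs =>
    (isOpen_ne.mem_nhds hs : {t | t ≠ s₀} ∈ nhds s) |> Filter.mem_of_superset <|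
      fun t ht => Function.update_of_ne ht _ _
  refine ⟨Function.update F s₀ (deriv A s₀ / 2), ?_, Function.update_self _ _ _,
    fun s hs => Function.update_of_ne hs _ _⟩
  intro s
  rcases eq_or_ne s s₀ with rfl | hs
  · refine (Complex.analyticAt_of_differentiable_on_punctured_nhds_of_continuousAt
      ?_ ?_).differentiableAt
    · exact eventually_nhdsWithin_of_forall fun t ht =>
        (hFd t ht).congr_of_eventuallyEq (hcongr t ht)
    · rw [continuousAt_update_same]
      have h1 := (hasDerivAt_iff_tendsto_slope.1 (hA s).hasDerivAt)
      have h2 : Filter.Tendsto (fun t => 2 * (t - s) + 1) (nhdsWithin s {s}ᶜ)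
          (nhdsWithin (1 : ℂ) {1}ᶜ) := by
        refine tendsto_nhdsWithin_iff.2 ⟨?_, eventually_nhdsWithin_of_forall hne⟩
        refine tendsto_nhdsWithin_of_tendsto_nhds ?_
        have : ContinuousAt (fun t : ℂ => 2 * (t - s) + 1) s := by fun_prop
        simpa [ContinuousAt] using this
      have h3 := (h1.mul (riemannZeta_residue_one.comp h2)).div_const 2
      rw [mul_one] at h3
      refine h3.congr' (eventually_nhdsWithin_of_forall fun t ht => ?_)
      have : t - s ≠ 0 := sub_ne_zero.2 ht
      simp only [slope_def_field, h0, Function.comp_apply, F]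
      field_simp
      ring
  · exact (hFd s hs).congr_of_eventuallyEq (hcongr s hs)

theorem exists_differentiable_cos_mul_binomNeg_mul_riemannZeta {k j : ℕ} (hj : j ≤ k) :
    ∃ B : ℂ → ℂ, Differentiable ℂ B ∧
      (∀ s : ℂ, 1 / 2 < s.re →
        B s = Complex.cos (Real.pi * s) * binomNeg k s * riemannZeta (2 * s + 2 * k - j)) ∧
      ∀ N : ℕ, ∃ b : ℚ, B (-(N : ℂ)) = b ∧ (k = N + 1 → (b ≠ 0 ↔ j = 1)) := by
  set s₀ : ℂ := (1 - 2 * k + j) / 2 with hs₀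
  have hcos : ∀ N : ℕ, Complex.cos (Real.pi * -(N : ℂ)) = (-1) ^ N := fun N => by
    rw [mul_neg, Complex.cos_neg, mul_comm]
    exact_mod_cast congrArg Complex.ofReal (Real.cos_nat_mul_pi N)
  have hA : Differentiable ℂ fun s => Complex.cos (Real.pi * s) * binomNeg k s := by
    have := differentiable_binomNeg k
    fun_prop
  have hA0 : Complex.cos (Real.pi * s₀) * binomNeg k s₀ = 0 := by
    rcases Nat.even_or_odd' j with ⟨i, rfl | rfl⟩
    · rw [Complex.cos_eq_zero_iff.2 ⟨(i : ℤ) - k, by rw [hs₀]; push_cast; ring⟩, zero_mul]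
    · have : s₀ = -((k - 1 - i : ℕ) : ℂ) := by
        rw [hs₀, Nat.cast_sub (by omega), Nat.cast_sub (by omega)]
        push_cast
        ring
      rw [this, binomNeg_neg_natCast_of_lt (by omega), mul_zero]
  obtain ⟨B, hB, hB0, hBs⟩ := exists_differentiable_mul_riemannZeta hA hA0
  refine ⟨B, hB, fun s hs => ?_, fun N => ?_⟩
  · rw [hBs]
    · congr 2
      rw [hs₀]
      ring
    · rintro rfl
      have : s₀.re = (1 - 2 * k + j) / 2 := by
        rw [hs₀, show (1 - 2 * (k : ℂ) + j) / 2 = ((1 - 2 * (k : ℝ) + j) / 2 : ℝ) by push_cast; rfl,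
          Complex.ofReal_re]
      have hjk : (j : ℝ) ≤ k := by exact_mod_cast hj
      have hk : (0 : ℝ) ≤ k := by positivity
      linarith
  · by_cases hN : -(N : ℂ) = s₀
    · have hkj : 2 * k = 2 * N + 1 + j := by
        have : (2 * k : ℂ) = 2 * N + 1 + j := by linear_combination 2 * hN + 2 * hs₀
        exact_mod_cast this
      have hNk : N < k := by omega
      obtain ⟨c, hc0, hc⟩ := exists_hasDerivAt_binomNeg hNk
      have hd : HasDerivAt (fun s => Complex.cos (Real.pi * s)) _ (-(N : ℂ)) :=
        (by fun_prop : Differentiable ℂ fun s : ℂ => Complex.cos (Real.pi * s)) _ |>.hasDerivAt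
      have h := (hd.mul hc).deriv
      rw [binomNeg_neg_natCast_of_lt hNk, mul_zero, zero_add, hcos] at h
      refine ⟨(-1) ^ N * c / 2, ?_, fun hk => ⟨fun _ => by omega, fun _ => ?_⟩⟩
      · rw [hN, hB0, ← hN]
        have h' : deriv (fun s => Complex.cos (Real.pi * s) * binomNeg k s) (-(N : ℂ))
          = (-1) ^ N * c := h
        rw [h']
        push_cast
        rfl
      · exact div_ne_zero (mul_ne_zero (pow_ne_zero _ (by norm_num)) hc0) two_ne_zero
    · rw [hBs _ hN, hcos]
      rcases lt_or_ge N k with hNk | hNk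
      · refine ⟨0, by rw [binomNeg_neg_natCast_of_lt hNk]; simp, fun hk => ?_⟩
        have : j ≠ 1 := by
          rintro rfl
          apply hN
          rw [hs₀, hk]
          push_cast
          ring
        simp [this]
      · refine ⟨(-1) ^ N * N.choose k *
          (-bernoulli' (2 * (N - k) + j + 1) / ((2 * (N - k) + j : ℕ) + 1)), ?_, by omega⟩
        have : 2 * (-(N : ℂ) - s₀) + 1 = -((2 * (N - k) + j : ℕ) : ℂ) := by
          rw [hs₀]
          push_cast [Nat.cast_sub hNk]
          ring
        rw [this, riemannZeta_neg_nat_eq_bernoulli', binomNeg_neg_natCast]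
        push_cast
        rfl

/-- The alternating zeta function `∑ (-1) ^ n / n ^ w`, which is entire. -/
noncomputable def altZeta : ℂ → ℂ := HurwitzZeta.cosZeta ((1 / 2 : ℝ) : UnitAddCircle)

theorem differentiable_altZeta : Differentiable ℂ altZeta := by
  refine HurwitzZeta.differentiable_cosZeta_of_ne_zero fun h => ?_
  rw [AddCircle.coe_eq_zero_iff] at h
  obtain ⟨n, hn⟩ := h
  have h2 : ((2 * n : ℤ) : ℝ) = 1 := by
    push_cast
    rw [zsmul_eq_mul] at hn
    linarith
  have h3 : 2 * n = 1 := by exact_mod_cast h2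
  omega

theorem hasSum_altZeta {w : ℂ} (hw : 1 < w.re) :
    HasSum (fun n : ℕ => (-1 : ℂ) ^ (n + 1) * ((n : ℂ) + 1) ^ (-w)) (altZeta w) := by
  have h := HurwitzZeta.hasSum_nat_cosZeta (1 / 2) hw
  have hw0 : w ≠ 0 := by
    rintro rfl
    norm_num at hw
  rw [← hasSum_nat_add_iff' 1] at h
  simp only [Finset.range_one, Finset.sum_singleton, Nat.cast_zero, Complex.zero_cpow hw0,
    div_zero, sub_zero] at h
  refine h.congr_fun fun n => ?_
  rw [show 2 * Real.pi * (1 / 2) * ((n + 1 : ℕ) : ℝ) = ((n + 1 : ℕ) : ℝ) * Real.pi by ring,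
    Real.cos_nat_mul_pi, Complex.cpow_neg, div_eq_mul_inv]
  push_cast
  rfl

theorem hasSum_riemannZeta {w : ℂ} (hw : 1 < w.re) :
    HasSum (fun n : ℕ => ((n : ℂ) + 1) ^ (-w)) (riemannZeta w) := by
  have h := (summable_nat_add_iff 1).2 (Complex.summable_one_div_nat_cpow.2 hw)
  rw [zeta_eq_tsum_one_div_nat_add_one_cpow hw]
  have heq : (fun n : ℕ => 1 / ((n + 1 : ℕ) : ℂ) ^ w) = fun n : ℕ => ((n : ℂ) + 1) ^ (-w) := by
    funext n
    rw [Complex.cpow_neg, one_div]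
    push_cast
    rfl
  rw [heq] at h
  simp_rw [one_div, ← Complex.cpow_neg]
  exact h.hasSum

theorem altZeta_eq {w : ℂ} (hw : 1 < w.re) :
    altZeta w = (2 * 2 ^ (-w) - 1) * riemannZeta w := by
  have h1 := (hasSum_altZeta hw).add (hasSum_riemannZeta hw)
  have hinj : Function.Injective fun n : ℕ => 2 * n + 1 := fun a b h => by simpa using h
  rw [← hinj.hasSum_iff] at h1
  · have h2 := (hasSum_riemannZeta hw).mul_left (2 * 2 ^ (-w) : ℂ)
    have h3 := h1.unique (h2.congr_fun fun n => ?_)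
    · linear_combination h3
    · simp only [Function.comp_apply]
      rw [show ((2 * n + 1 : ℕ) : ℂ) + 1 = ((2 : ℕ) : ℂ) * ((n + 1 : ℕ) : ℂ) by push_cast; ring,
        Complex.natCast_mul_natCast_cpow, show 2 * n + 1 + 1 = 2 * (n + 1) by ring, pow_mul]
      push_cast
      ring
  · intro m hm
    rcases Nat.even_or_odd' m with ⟨i, rfl | rfl⟩
    · rw [pow_succ, pow_mul]
      simp
    · exact absurd ⟨i, rfl⟩ hm

theorem exists_altZeta_two_mul (l : ℕ) (hl : l ≠ 0) :
    ∃ r : ℚ, r ≠ 0 ∧ altZeta (2 * l) = r * (Real.pi : ℂ) ^ (2 * l) := by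
  have hre : (2 * l : ℂ).re = 2 * (l : ℝ) := by simp
  have hl1 : (1 : ℝ) ≤ l := by exact_mod_cast Nat.one_le_iff_ne_zero.2 hl
  have hw : 1 < (2 * l : ℂ).re := by
    rw [hre]
    linarith
  have hne : altZeta (2 * l) ≠ 0 := by
    rw [altZeta_eq hw]
    refine mul_ne_zero (fun h => ?_) (riemannZeta_ne_zero_of_one_lt_re hw)
    have h1 : (2 : ℂ) ^ (2 * l : ℂ) = 2 := by
      rw [Complex.cpow_neg] at h
      have h2 : (2 : ℂ) ^ (2 * l : ℂ) ≠ 0 := by simp [Complex.cpow_eq_zero_iff]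
      field_simp at h
      linear_combination -h
    have h2 : (2 : ℕ) ^ (2 * l) = 2 ^ 1 := by
      have : (2 : ℂ) ^ (2 * l : ℕ) = 2 := by
        rw [← Complex.cpow_natCast]
        push_cast
        exact h1
      exact_mod_cast this
    have := Nat.pow_right_injective le_rfl h2
    omega
  have h := HurwitzZeta.cosZeta_two_mul_nat (x := 1 / 2) hl (by constructor <;> norm_num)
  have hev : ((Polynomial.bernoulli (2 * l)).map (algebraMap ℚ ℂ)).eval ((1 / 2 : ℝ) : ℂ)
      = (((Polynomial.bernoulli (2 * l)).eval (1 / 2) : ℚ) : ℂ) := by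
    rw [show ((1 / 2 : ℝ) : ℂ) = algebraMap ℚ ℂ (1 / 2) by simp, Polynomial.eval_map_apply]
    rfl
  rw [hev] at h
  refine ⟨(-1) ^ (l + 1) * 2 ^ (2 * l) / 2 / (2 * l).factorial *
    (Polynomial.bernoulli (2 * l)).eval (1 / 2), ?_, ?_⟩
  · intro h0
    apply hne
    rw [altZeta, h]
    rw [mul_eq_zero] at h0
    rcases h0 with h0 | h0
    · exact absurd h0 (by positivity)
    · rw [h0]
      simp
  · rw [altZeta, h]
    push_cast
    ring

theorem exists_altZeta_neg_two_mul (l : ℕ) : ∃ r : ℚ, altZeta (-(2 * l)) = r := by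
  rcases l with _ | l
  · refine ⟨-1 / 2, ?_⟩
    simp [altZeta, HurwitzZeta.cosZeta_apply_zero]
  · refine ⟨0, ?_⟩
    have := HurwitzZeta.cosZeta_neg_two_mul_nat_add_one ((1 / 2 : ℝ) : UnitAddCircle) l
    rw [altZeta]
    push_cast
    rw [← this]
    ring_nf

theorem exists_altZeta_mul_sub {q : ℕ} (hq : Even q) (hq0 : q ≠ 0) (k N : ℕ) :
    ∃ r : ℚ, altZeta (q * ((k : ℂ) - N)) = r * (Real.pi : ℂ) ^ (q * (k - N)) ∧
      (N < k → r ≠ 0) := by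
  obtain ⟨p, rfl⟩ := hq.two_dvd
  rcases lt_or_ge N k with h | h
  · obtain ⟨r, hr0, hr⟩ := exists_altZeta_two_mul (p * (k - N))
      (mul_ne_zero (by rintro rfl; simp at hq0) (by omega))
    refine ⟨r, ?_, fun _ => hr0⟩
    rw [mul_assoc, ← hr]
    push_cast [Nat.cast_sub h.le]
    ring_nf
  · obtain ⟨r, hr⟩ := exists_altZeta_neg_two_mul (p * (N - k))
    refine ⟨r, ?_, fun h' => absurd h' (not_lt.2 h)⟩
    rw [Nat.sub_eq_zero_of_le h, mul_zero, pow_zero, mul_one, ← hr]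
    push_cast [Nat.cast_sub h]
    ring_nf

open Filter Topology in
theorem DifferentiableOn.eqOn_zero_of_preconnected_of_eventuallyEq {E : Type*}
    [NormedAddCommGroup E] [NormedSpace ℂ E] {f : E → ℂ} {U : Set E} (hf : DifferentiableOn ℂ f U)
    (hU : IsOpen U) (hc : IsPreconnected U) {z₀ : E} (h₀ : z₀ ∈ U) (hz : f =ᶠ[𝓝 z₀] 0) :
    Set.EqOn f 0 U := by
  suffices h : U ⊆ {x | f =ᶠ[𝓝 x] 0} from fun x hx => (h hx).eq_of_nhds
  refine hc.subset_of_closure_inter_subset isOpen_setOfPred_eventually_nhds ⟨z₀, h₀, hz⟩ ?_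
  rintro x ⟨hx, hxU⟩
  obtain ⟨r, hr, hrU⟩ := Metric.isOpen_iff.1 hU x hxU
  obtain ⟨a, haf, ha⟩ := mem_closure_iff_nhds.1 hx _ (Metric.ball_mem_nhds x hr)
  refine Filter.mem_of_superset (Metric.ball_mem_nhds x hr) fun y hy => ?_
  set L : ℂ → E := fun t => a + t • (y - a) with hL
  have hLd : Differentiable ℂ L := by fun_prop
  have hT : Convex ℝ (L ⁻¹' Metric.ball x r) := by
    intro s hs t ht α β hα hβ hαβ
    have h := (convex_ball x r) hs ht hα hβ hαβ
    have h' : L (α • s + β • t) = α • L s + β • L t := by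
      obtain rfl : α = 1 - β := by linarith
      simp only [hL, smul_add, add_smul, smul_assoc]
      module
    rwa [Set.mem_preimage, h']
  have hTo : IsOpen (L ⁻¹' Metric.ball x r) := Metric.isOpen_ball.preimage hLd.continuous
  have hL0 : L 0 = a := by simp [hL]
  have hL1 : L 1 = y := by simp [hL]
  have hg : DifferentiableOn ℂ (f ∘ L) (L ⁻¹' Metric.ball x r) :=
    hf.comp hLd.differentiableOn fun t ht => hrU ht
  have hev : f ∘ L =ᶠ[𝓝 0] 0 := by
    have : Tendsto L (𝓝 0) (𝓝 a) := hL0 ▸ hLd.continuous.tendsto 0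
    exact this.eventually ha
  have h := (hg.analyticOnNhd hTo).eqOn_zero_of_preconnected_of_eventuallyEq_zero
    hT.isPreconnected (z₀ := 0) (by simpa [hL0] using haf) hev
  have h1 := h (x := 1) (by simpa [hL1] using hy)
  simpa [hL1] using h1

/-- The general term of the double series. -/
noncomputable def seriesTerm (q : ℕ) (s : ℂ) (m : ℕ × ℕ) : ℂ :=
  (-1 : ℂ) ^ (m.1 + 1) * ((1 + ((m.2 : ℝ) + 1) +
    ((m.1 : ℝ) + 1) ^ q * ((m.2 : ℝ) + 1) ^ 2 : ℝ) : ℂ) ^ (-s)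

/-- The part of the general term coming from the dominant monomial `X_1 ^ q X_2 ^ 2`. -/
noncomputable def dominantTerm (q : ℕ) (s : ℂ) (m : ℕ × ℕ) : ℂ :=
  (-1 : ℂ) ^ (m.1 + 1) * ((m.1 : ℂ) + 1) ^ (-(q * s)) * ((m.2 : ℂ) + 1) ^ (-(2 * s))

/-- The quotient of `1 + X_2` by the dominant monomial. -/
noncomputable def quotTerm (q : ℕ) (m : ℕ × ℕ) : ℝ :=
  ((m.2 : ℝ) + 2) / (((m.1 : ℝ) + 1) ^ q * ((m.2 : ℝ) + 1) ^ 2)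

theorem quotTerm_nonneg (q : ℕ) (m : ℕ × ℕ) : 0 ≤ quotTerm q m := by
  unfold quotTerm; positivity

theorem quotTerm_le (q : ℕ) (m : ℕ × ℕ) :
    quotTerm q m ≤ 2 * (((m.1 : ℝ) + 1) ^ q * ((m.2 : ℝ) + 1))⁻¹ := by
  unfold quotTerm
  have h1 : (0 : ℝ) < ((m.1 : ℝ) + 1) ^ q := by positivity
  have h2 : (0 : ℝ) < (m.2 : ℝ) + 1 := by positivity
  rw [← div_eq_mul_inv, div_le_div_iff₀ (by positivity) (by positivity)]
  have : 0 ≤ ((m.1 : ℝ) + 1) ^ q * ((m.2 : ℝ) + 1) * (m.2 : ℝ) := by positivity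
  nlinarith

theorem quotTerm_le_two (q : ℕ) (m : ℕ × ℕ) : quotTerm q m ≤ 2 := by
  refine (quotTerm_le q m).trans ?_
  have h1 : (1 : ℝ) ≤ ((m.1 : ℝ) + 1) ^ q := one_le_pow₀ (by simp)
  have h2 : (1 : ℝ) ≤ (m.2 : ℝ) + 1 := by simp
  have := inv_le_one_of_one_le₀ (one_le_mul_of_one_le_of_one_le h1 h2)
  linarith

theorem seriesTerm_eq_dominantTerm_mul (q : ℕ) (s : ℂ) (m : ℕ × ℕ) :
    seriesTerm q s m = dominantTerm q s m * ((1 + quotTerm q m : ℝ) : ℂ) ^ (-s) := by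
  obtain ⟨a, b⟩ := m
  have ha : (0 : ℝ) < (a : ℝ) + 1 := by positivity
  have hb : (0 : ℝ) < (b : ℝ) + 1 := by positivity
  have h : (1 + ((b : ℝ) + 1) + ((a : ℝ) + 1) ^ q * ((b : ℝ) + 1) ^ 2 : ℝ) =
      (((a + 1) ^ q * (b + 1) ^ 2 : ℕ) : ℝ) * (1 + quotTerm q (a, b)) := by
    simp only [quotTerm]
    push_cast
    field_simp
    ring
  have h0 : 0 ≤ 1 + quotTerm q (a, b) := by linarith [quotTerm_nonneg q (a, b)]
  rw [seriesTerm, dominantTerm]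
  dsimp only
  rw [h, Complex.ofReal_mul, Complex.mul_cpow_ofReal_nonneg (Nat.cast_nonneg _) h0,
    Complex.ofReal_natCast, Nat.cast_mul, Complex.natCast_mul_natCast_cpow, Nat.cast_pow,
    Nat.cast_pow, ← Complex.natCast_cpow_natCast_mul, ← Complex.natCast_cpow_natCast_mul]
  push_cast
  ring_nf

theorem dominantTerm_mul_quotTerm_pow (q k : ℕ) (s : ℂ) (m : ℕ × ℕ) :
    dominantTerm q s m * (quotTerm q m : ℂ) ^ k = ∑ j ∈ Finset.range (k + 1), (k.choose j : ℂ) *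
      (((-1 : ℂ) ^ (m.1 + 1) * ((m.1 : ℂ) + 1) ^ (-(q * (s + k)))) *
        ((m.2 : ℂ) + 1) ^ (-(2 * s + 2 * k - j))) := by
  obtain ⟨a, b⟩ := m
  have ha : (a : ℂ) + 1 ≠ 0 := Nat.cast_add_one_ne_zero a
  have hb : (b : ℂ) + 1 ≠ 0 := Nat.cast_add_one_ne_zero b
  have h1 : ((a : ℂ) + 1) ^ (-(q * (s + k))) =
      ((a : ℂ) + 1) ^ (-(q * s)) * (((a : ℂ) + 1) ^ (q * k))⁻¹ := by
    rw [← Complex.cpow_natCast, ← Complex.cpow_neg, ← Complex.cpow_add _ _ ha]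
    push_cast
    ring_nf
  have h2 (j : ℕ) : ((b : ℂ) + 1) ^ (-(2 * s + 2 * k - j)) =
      ((b : ℂ) + 1) ^ (-(2 * s)) * (((b : ℂ) + 1) ^ (2 * k))⁻¹ * ((b : ℂ) + 1) ^ j := by
    rw [← Complex.cpow_natCast _ (2 * k), ← Complex.cpow_neg, ← Complex.cpow_natCast _ j,
      ← Complex.cpow_add _ _ hb, ← Complex.cpow_add _ _ hb]
    push_cast
    ring_nf
  have h3 : (quotTerm q (a, b) : ℂ) ^ k = (∑ j ∈ Finset.range (k + 1),
      ((b : ℂ) + 1) ^ j * (k.choose j : ℂ)) * (((a : ℂ) + 1) ^ (q * k))⁻¹ *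
        (((b : ℂ) + 1) ^ (2 * k))⁻¹ := by
    have := add_pow ((b : ℂ) + 1) 1 k
    simp only [one_pow, mul_one] at this
    rw [← this, quotTerm]
    push_cast
    rw [div_pow, mul_pow, ← pow_mul, ← pow_mul, div_eq_mul_inv, mul_inv, mul_assoc,
      add_assoc, one_add_one_eq_two]
  rw [h3, Finset.sum_mul, Finset.sum_mul, Finset.mul_sum]
  refine Finset.sum_congr rfl fun j _ => ?_
  simp only [dominantTerm, h1, h2]
  ring

open Finset in
theorem seriesTerm_eq_sum_add (q M : ℕ) (s : ℂ) (m : ℕ × ℕ) :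
    seriesTerm q s m = ∑ k ∈ range M, ∑ j ∈ range (k + 1), (k.choose j : ℂ) * binomNeg k s *
      (((-1 : ℂ) ^ (m.1 + 1) * ((m.1 : ℂ) + 1) ^ (-(q * (s + k)))) *
        ((m.2 : ℂ) + 1) ^ (-(2 * s + 2 * k - j))) +
      dominantTerm q s m * binomRem M s (quotTerm q m) := by
  have h : ((1 + quotTerm q m : ℝ) : ℂ) ^ (-s) = ∑ k ∈ range M, binomNeg k s *
      (quotTerm q m : ℂ) ^ k + binomRem M s (quotTerm q m) := by rw [binomRem]; ring
  rw [seriesTerm_eq_dominantTerm_mul, h, mul_add, mul_sum]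
  congr 1
  refine sum_congr rfl fun k _ => ?_
  rw [mul_left_comm, dominantTerm_mul_quotTerm_pow, mul_sum]
  exact sum_congr rfl fun j _ => by ring

theorem HasSum.mul_prod {f g : ℕ → ℂ} {a b : ℂ} (hf : HasSum f a) (hg : HasSum g b) :
    HasSum (fun m : ℕ × ℕ => f m.1 * g m.2) (a * b) :=
  hf.mul hg (summable_mul_of_summable_norm hf.summable.norm hg.summable.norm)

theorem hasSum_mainTerm {q : ℕ} (hq : 2 ≤ q) {k j : ℕ} (hj : j ≤ k) {s : ℂ} (hs : 1 / 2 < s.re) :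
    HasSum (fun m : ℕ × ℕ => ((-1 : ℂ) ^ (m.1 + 1) * ((m.1 : ℂ) + 1) ^ (-(q * (s + k)))) *
        ((m.2 : ℂ) + 1) ^ (-(2 * s + 2 * k - j)))
      (altZeta (q * (s + k)) * riemannZeta (2 * s + 2 * k - j)) := by
  have hq' : (2 : ℝ) ≤ q := by exact_mod_cast hq
  have hj' : (j : ℝ) ≤ k := by exact_mod_cast hj
  have hk : (0 : ℝ) ≤ k := by positivity
  have h1 : 1 < (q * (s + k) : ℂ).re := by
    have : 2 * s.re ≤ q * (s.re + k) :=
      mul_le_mul hq' (by linarith) (by linarith) (by linarith)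
    simp
    linarith
  have h2 : 1 < (2 * s + 2 * k - j : ℂ).re := by
    simp
    linarith
  have ha := hasSum_altZeta h1
  have hb := hasSum_riemannZeta h2
  have hc := ha.mul_prod hb
  exact hc

theorem exists_norm_dominantTerm_mul_binomRem_le {q : ℕ} (hq : 2 ≤ q) (B : ℕ) :
    ∃ C : ℝ, ∀ s : ℂ, ‖s‖ ≤ B → ∀ m : ℕ × ℕ,
      ‖dominantTerm q s m * binomRem (2 * B + 2) s (quotTerm q m)‖ ≤
        C * ((1 / ((m.1 : ℝ) + 1) ^ 2) * (1 / ((m.2 : ℝ) + 1) ^ 2)) := by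
  obtain ⟨C, hC, h⟩ := exists_norm_binomRem_le (2 * B + 2) B
  refine ⟨C * 2 ^ (2 * B + 2), fun s hs m => ?_⟩
  have hx := h s hs (quotTerm q m) ⟨quotTerm_nonneg q m, quotTerm_le_two q m⟩
  have hpow := pow_le_pow_left₀ (quotTerm_nonneg q m) (quotTerm_le q m) (2 * B + 2)
  obtain ⟨a, b⟩ := m
  have ha1 : (1 : ℝ) ≤ (a : ℝ) + 1 := by simp
  have hb1 : (1 : ℝ) ≤ (b : ℝ) + 1 := by simp
  have hs' : -s.re ≤ B := by
    have := (abs_le.1 (Complex.abs_re_le_norm s)).1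
    linarith
  have hna : ‖((a : ℂ) + 1) ^ (-(q * s))‖ ≤ ((a : ℝ) + 1) ^ (q * B) := by
    have : (a : ℂ) + 1 = ((a + 1 : ℕ) : ℂ) := by push_cast; rfl
    rw [this, Complex.norm_natCast_cpow_of_pos (Nat.succ_pos a), ← Real.rpow_natCast]
    push_cast
    refine Real.rpow_le_rpow_of_exponent_le ha1 ?_
    simp only [Complex.neg_re, Complex.mul_re, Complex.natCast_re, Complex.natCast_im, zero_mul,
      sub_zero]
    nlinarith [(Nat.cast_nonneg q : (0 : ℝ) ≤ q)]
  have hnb : ‖((b : ℂ) + 1) ^ (-(2 * s))‖ ≤ ((b : ℝ) + 1) ^ (2 * B) := by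
    have : (b : ℂ) + 1 = ((b + 1 : ℕ) : ℂ) := by push_cast; rfl
    rw [this, Complex.norm_natCast_cpow_of_pos (Nat.succ_pos b), ← Real.rpow_natCast]
    push_cast
    refine Real.rpow_le_rpow_of_exponent_le hb1 ?_
    simp
    nlinarith
  have hd : ‖dominantTerm q s (a, b)‖ ≤ ((a : ℝ) + 1) ^ (q * B) * ((b : ℝ) + 1) ^ (2 * B) := by
    rw [dominantTerm, norm_mul, norm_mul, norm_pow, norm_neg, norm_one, one_pow, one_mul]
    exact mul_le_mul hna hnb (norm_nonneg _) (by positivity)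
  have hA : ((a : ℝ) + 1) ^ (q * B) * ((((a : ℝ) + 1) ^ q) ^ (2 * B + 2))⁻¹ ≤
      1 / ((a : ℝ) + 1) ^ 2 := by
    rw [← div_eq_mul_inv, div_le_div_iff₀ (by positivity) (by positivity), one_mul, ← pow_mul,
      ← pow_add]
    exact pow_le_pow_right₀ ha1 (by nlinarith)
  have hB : ((b : ℝ) + 1) ^ (2 * B) * (((b : ℝ) + 1) ^ (2 * B + 2))⁻¹ =
      1 / ((b : ℝ) + 1) ^ 2 := by
    rw [pow_add]
    field_simp
  rw [norm_mul]
  calc _ ≤ (((a : ℝ) + 1) ^ (q * B) * ((b : ℝ) + 1) ^ (2 * B)) *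
        (C * (2 * (((a : ℝ) + 1) ^ q * ((b : ℝ) + 1))⁻¹) ^ (2 * B + 2)) := by
        exact mul_le_mul hd (hx.trans (by gcongr)) (norm_nonneg _) (by positivity)
    _ = C * 2 ^ (2 * B + 2) * ((((a : ℝ) + 1) ^ (q * B) * ((((a : ℝ) + 1) ^ q) ^ (2 * B + 2))⁻¹) *
        (((b : ℝ) + 1) ^ (2 * B) * (((b : ℝ) + 1) ^ (2 * B + 2))⁻¹)) := by
        rw [mul_pow, inv_pow, mul_pow, mul_inv]
        ring
    _ ≤ _ := by
        rw [hB]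
        gcongr

theorem summable_one_div_sq_mul_one_div_sq :
    Summable fun m : ℕ × ℕ => (1 / ((m.1 : ℝ) + 1) ^ 2) * (1 / ((m.2 : ℝ) + 1) ^ 2) := by
  have h : Summable fun n : ℕ => 1 / ((n : ℝ) + 1) ^ 2 := by
    have := (summable_nat_add_iff 1).2 (Real.summable_one_div_nat_pow.2 one_lt_two)
    exact_mod_cast this
  exact h.mul_of_nonneg h (fun n => by positivity) (fun n => by positivity)

open Finset Polynomial in
theorem transcendental_sum_mul_pi_pow {q M N : ℕ} (hq : q ≠ 0) (hN : N + 1 < M) {c : ℕ → ℚ}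
    (hc : c (N + 1) ≠ 0) :
    Transcendental ℚ (∑ k ∈ range M, (c k : ℂ) * (Real.pi : ℂ) ^ (q * (k - N))) := by
  set f : ℚ[X] := ∑ k ∈ range M, C (c k) * X ^ (q * (k - N)) with hf
  have hfe : ∑ k ∈ range M, (c k : ℂ) * (Real.pi : ℂ) ^ (q * (k - N)) =
      aeval (Real.pi : ℂ) f := by simp [hf]
  have hcoeff : f.coeff q = c (N + 1) := by
    rw [hf, finsetSum_coeff, sum_eq_single (N + 1)]
    · simp
    · intro k _ hk
      rw [coeff_C_mul_X_pow, if_neg]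
      intro h
      have : k - N = 1 := by
        have := Nat.eq_of_mul_eq_mul_left (Nat.pos_of_ne_zero hq) (h.symm.trans (mul_one q).symm)
        exact this
      omega
    · intro h
      exact absurd (mem_range.2 hN) h
  rw [hfe]
  refine transcendental_pi.aeval f (fun h => hc ?_) (mem_nonZeroDivisors_of_ne_zero fun h => hc ?_)
  · rw [← hcoeff, coeff_eq_zero_of_natDegree_lt (by omega)]
  · rw [← hcoeff, leadingCoeff_eq_zero.1 h, coeff_zero]

open Finset in
theorem exists_differentiableOn_ball {q : ℕ} (hqe : Even q) (hq : 2 ≤ q) (B : ℕ) :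
    ∃ G : ℂ → ℂ, DifferentiableOn ℂ G (Metric.ball 0 B) ∧
      (∀ s ∈ Metric.ball (0 : ℂ) B, 1 / 2 < s.re → Summable (seriesTerm q s) ∧
        G s = Complex.cos (Real.pi * s) * ∑' m, seriesTerm q s m) ∧
      ∀ N < B, Transcendental ℚ (G (-(N : ℂ))) := by
  have hq0 : q ≠ 0 := by omega
  have hF : ∀ k j : ℕ, ∃ F : ℂ → ℂ, j ≤ k → Differentiable ℂ F ∧
      (∀ s, 1 / 2 < s.re →
        F s = Complex.cos (Real.pi * s) * binomNeg k s * riemannZeta (2 * s + 2 * k - j)) ∧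
      ∀ N : ℕ, ∃ b : ℚ, F (-(N : ℂ)) = b ∧ (k = N + 1 → (b ≠ 0 ↔ j = 1)) := by
    intro k j
    by_cases hj : j ≤ k
    · obtain ⟨F, h⟩ := exists_differentiable_cos_mul_binomNeg_mul_riemannZeta hj
      exact ⟨F, fun _ => h⟩
    · exact ⟨0, fun h => absurd h hj⟩
  choose F hF using hF
  obtain ⟨C, hC⟩ := exists_norm_dominantTerm_mul_binomRem_le hq B
  have hS := summable_one_div_sq_mul_one_div_sq.mul_left C
  set R : ℂ → ℕ × ℕ → ℂ := fun s m => dominantTerm q s m * binomRem (2 * B + 2) s (quotTerm q m)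
    with hR
  have hRle : ∀ s ∈ Metric.ball (0 : ℂ) B, ∀ m, ‖R s m‖ ≤
      C * ((1 / ((m.1 : ℝ) + 1) ^ 2) * (1 / ((m.2 : ℝ) + 1) ^ 2)) := fun s hs m =>
    hC s (by simpa using (Metric.mem_ball.1 hs).le) m
  have hdom (m : ℕ × ℕ) : Differentiable ℂ fun s => dominantTerm q s m := by
    have ha : (m.1 : ℂ) + 1 ≠ 0 := Nat.cast_add_one_ne_zero _
    have hb : (m.2 : ℂ) + 1 ≠ 0 := Nat.cast_add_one_ne_zero _
    unfold dominantTerm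
    refine Differentiable.mul (Differentiable.mul (differentiable_const _) ?_) ?_
    · exact Differentiable.const_cpow (by fun_prop) (Or.inl ha)
    · exact Differentiable.const_cpow (by fun_prop) (Or.inl hb)
  have hRd : DifferentiableOn ℂ (fun s => ∑' m, R s m) (Metric.ball 0 B) :=
    Complex.differentiableOn_tsum_of_summable_norm hS
      (fun m => ((hdom m).mul
        (differentiable_binomRem _ (quotTerm_nonneg q m))).differentiableOn)
      Metric.isOpen_ball fun m s hs => hRle s hs m
  refine ⟨fun s => ∑ k ∈ range (2 * B + 2), ∑ j ∈ range (k + 1),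
    (k.choose j : ℂ) * (altZeta (q * (s + k)) * F k j s) +
      Complex.cos (Real.pi * s) * ∑' m, R s m, ?_, ?_, ?_⟩
  · refine DifferentiableOn.add (DifferentiableOn.fun_sum fun k _ =>
      DifferentiableOn.fun_sum fun j hj => ?_) (DifferentiableOn.mul ?_ hRd)
    · have hd : Differentiable ℂ fun s : ℂ => altZeta (q * (s + k)) :=
        differentiable_altZeta.comp (by fun_prop)
      exact ((hd.mul (hF k j (mem_range_succ_iff.1 hj)).1).const_mul _).differentiableOn
    · exact (Complex.differentiable_cos.comp (by fun_prop)).differentiableOn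
  · intro s hs hs2
    have h1 : HasSum (R s) (∑' m, R s m) :=
      (Summable.of_norm_bounded hS (hRle s hs)).hasSum
    have h2 : HasSum (seriesTerm q s) (∑ k ∈ range (2 * B + 2), ∑ j ∈ range (k + 1),
        (k.choose j : ℂ) * binomNeg k s * (altZeta (q * (s + k)) * riemannZeta (2 * s + 2 * k - j))
          + ∑' m, R s m) := by
      rw [funext (seriesTerm_eq_sum_add q (2 * B + 2) s)]
      refine HasSum.add (hasSum_sum fun k _ => hasSum_sum fun j hj => ?_) h1
      exact (hasSum_mainTerm hq (mem_range_succ_iff.1 hj) hs2).mul_left _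
    refine ⟨h2.summable, ?_⟩
    rw [h2.tsum_eq, mul_add, mul_sum]
    refine congrArg (· + _) ?_
    refine sum_congr rfl fun k _ => ?_
    rw [mul_sum]
    refine sum_congr rfl fun j hj => ?_
    rw [(hF k j (mem_range_succ_iff.1 hj)).2.1 s hs2]
    ring
  · intro N hN
    have hb : ∀ k j : ℕ, ∃ b : ℚ, j ≤ k → F k j (-(N : ℂ)) = b ∧ (k = N + 1 → (b ≠ 0 ↔ j = 1)) := by
      intro k j
      by_cases hj : j ≤ k
      · obtain ⟨b, h⟩ := (hF k j hj).2.2 N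
        exact ⟨b, fun _ => h⟩
      · exact ⟨0, fun h => absurd h hj⟩
    choose b hb using hb
    choose r hr using fun k => exists_altZeta_mul_sub hqe hq0 k N
    have hR0 (m : ℕ × ℕ) : R (-(N : ℂ)) m = 0 := by
      rw [hR]
      simp only
      rw [binomRem_neg_natCast (by omega), mul_zero]
    have hsum : ∑ j ∈ range (N + 1 + 1), ((N + 1).choose j : ℚ) * b (N + 1) j =
        (N + 1) * b (N + 1) 1 := by
      rw [sum_eq_single 1]
      · simp
      · intro j hj h1
        have := (hb (N + 1) j (mem_range_succ_iff.1 hj)).2 rfl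
        rw [not_not.1 ((not_congr this).2 h1), mul_zero]
      · intro h
        exact absurd (mem_range.2 (by omega)) h
    have hc : r (N + 1) * ∑ j ∈ range (N + 1 + 1), ((N + 1).choose j : ℚ) * b (N + 1) j ≠ 0 := by
      rw [hsum]
      refine mul_ne_zero ((hr _).2 (Nat.lt_succ_self N)) (mul_ne_zero (by positivity) ?_)
      exact ((hb (N + 1) 1 (by omega)).2 rfl).2 rfl
    have := transcendental_sum_mul_pi_pow (M := 2 * B + 2) (N := N) hq0 (by omega)
      (c := fun k => r k * ∑ j ∈ range (k + 1), (k.choose j : ℚ) * b k j) hc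
    convert this using 1
    simp only [hR0, tsum_zero, mul_zero, add_zero]
    refine sum_congr rfl fun k _ => ?_
    rw [neg_add_eq_sub, (hr k).1]
    push_cast
    rw [mul_sum, sum_mul]
    refine sum_congr rfl fun j hj => ?_
    rw [(hb k j (mem_range_succ_iff.1 hj)).1]
    ring

theorem exists_differentiable_cos_mul_tsum {q : ℕ} (hqe : Even q) (hq : 2 ≤ q) :
    ∃ G : ℂ → ℂ, Differentiable ℂ G ∧
      (∀ s : ℂ, 1 / 2 < s.re → G s = Complex.cos (Real.pi * s) * ∑' m, seriesTerm q s m) ∧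
      ∀ N : ℕ, Transcendental ℚ (G (-(N : ℂ))) := by
  choose H hHd hHs hHt using exists_differentiableOn_ball hqe hq
  have hsub {B B' : ℕ} (h : B ≤ B') : Metric.ball (0 : ℂ) B ⊆ Metric.ball 0 B' :=
    Metric.ball_subset_ball (by exact_mod_cast h)
  have heq {B B' : ℕ} (hB : 2 ≤ B) (h : B ≤ B') : Set.EqOn (H B) (H B') (Metric.ball 0 B) := by
    have hmem : (1 : ℂ) ∈ Metric.ball (0 : ℂ) B := by
      have : (1 : ℝ) < B := by exact_mod_cast hB
      simpa using this
    refine ((hHd B).analyticOnNhd Metric.isOpen_ball).eqOn_of_preconnected_of_eventuallyEq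
      (((hHd B').mono (hsub h)).analyticOnNhd Metric.isOpen_ball)
      (convex_ball _ _).isPreconnected hmem ?_
    have hre : ∀ᶠ s : ℂ in nhds 1, 1 / 2 < s.re :=
      Complex.continuous_re.continuousAt.eventually (lt_mem_nhds (by norm_num))
    filter_upwards [Metric.isOpen_ball.mem_nhds hmem, hre] with s hs hs2
    rw [(hHs B s hs hs2).2, (hHs B' s (hsub h hs) hs2).2]
  have hmem (s : ℂ) : s ∈ Metric.ball (0 : ℂ) (⌊‖s‖⌋₊ + 2 : ℕ) := by
    have := Nat.lt_floor_add_one ‖s‖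
    simp only [Metric.mem_ball, dist_zero_right]
    push_cast
    linarith
  have hG {s : ℂ} {B : ℕ} (hB : 2 ≤ B) (hs : s ∈ Metric.ball (0 : ℂ) B) :
      H (⌊‖s‖⌋₊ + 2) s = H B s := by
    rcases le_total (⌊‖s‖⌋₊ + 2) B with h | h
    · exact heq (by omega) h (hmem s)
    · exact (heq hB h hs).symm
  refine ⟨fun s => H (⌊‖s‖⌋₊ + 2) s, fun s => ?_, fun s hs => (hHs _ s (hmem s) hs).2, fun N => ?_⟩
  · have hev : (fun s => H (⌊‖s‖⌋₊ + 2) s) =ᶠ[nhds s] H (⌊‖s‖⌋₊ + 2) := by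
      filter_upwards [Metric.isOpen_ball.mem_nhds (hmem s)] with t ht
      exact hG (by omega) ht
    exact ((hHd _).differentiableAt (Metric.isOpen_ball.mem_nhds (hmem s))).congr_of_eventuallyEq hev
  · exact hHt _ N (by simp)

theorem summable_seriesTerm {q : ℕ} (hqe : Even q) (hq : 2 ≤ q) {s : ℂ} (hs : 1 / 2 < s.re) :
    Summable (seriesTerm q s) := by
  obtain ⟨B, hB⟩ := exists_nat_gt ‖s‖
  obtain ⟨G, -, h, -⟩ := exists_differentiableOn_ball hqe hq B
  exact (h s (by simpa using hB) hs).1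

theorem half_lt_re_of_summable_seriesTerm {q : ℕ} {s : ℂ} (h : Summable (seriesTerm q s)) :
    1 / 2 < s.re := by
  by_contra! hs
  have h0 : Summable fun n : ℕ => seriesTerm q s (0, n) :=
    h.comp_injective (Prod.mk_right_injective 0)
  have hnorm (n : ℕ) : ‖seriesTerm q s (0, n)‖ =
      (1 + ((n : ℝ) + 1) + ((n : ℝ) + 1) ^ 2) ^ (-s.re) := by
    rw [seriesTerm, norm_mul, norm_pow, norm_neg, norm_one, one_pow, one_mul,
      Complex.norm_cpow_eq_rpow_re_of_pos (by positivity)]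
    simp
  have hle (n : ℕ) : (3 : ℝ)⁻¹ * (1 / ((n : ℝ) + 1)) ≤ ‖seriesTerm q s (0, n)‖ := by
    rw [hnorm]
    have hn : (0 : ℝ) ≤ n := n.cast_nonneg
    have hx : (1 : ℝ) ≤ 1 + ((n : ℝ) + 1) + ((n : ℝ) + 1) ^ 2 := by nlinarith
    calc (3 : ℝ)⁻¹ * (1 / ((n : ℝ) + 1)) = (3 * ((n : ℝ) + 1))⁻¹ := by
          rw [mul_inv, one_div]
      _ = ((3 * ((n : ℝ) + 1)) ^ 2) ^ (-(1 / 2) : ℝ) := by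
          rw [Real.rpow_neg (by positivity), ← Real.sqrt_eq_rpow, Real.sqrt_sq (by positivity)]
      _ ≤ (1 + ((n : ℝ) + 1) + ((n : ℝ) + 1) ^ 2) ^ (-(1 / 2) : ℝ) :=
          Real.rpow_le_rpow_of_nonpos (by positivity) (by nlinarith) (by norm_num)
      _ ≤ _ := Real.rpow_le_rpow_of_exponent_le hx (by linarith)
  have h1 : Summable fun n : ℕ => (3 : ℝ)⁻¹ * (1 / ((n : ℝ) + 1)) :=
    Summable.of_nonneg_of_le (fun n => by positivity) hle h0.norm
  have h2 := (summable_mul_left_iff (by norm_num : (3 : ℝ)⁻¹ ≠ 0)).1 h1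
  refine Real.not_summable_one_div_natCast ((summable_nat_add_iff 1).1 ?_)
  exact_mod_cast h2

/-- transcendence of the values at non-positive integers of the double
series `ζ_2(s_1,s_2) = Σ_{m_1,m_2 ≥ 1} (−1)^{m_1} (1 + m_2 + m_1^q m_2^2)^{−s_2}`
(the partially twisted series with `P_1 = 1`, `P_2 = 1 + X_2 + X_1^q X_2^2`, `μ_1 = −1`),
for `q` a positive even integer. -/
theorem stmt_19 (q : ℕ) (hq : 0 < q) (hqe : Even q) (N1 N2 : ℕ)
    (U : Set (ℂ × ℂ)) (Z : ℂ × ℂ → ℂ) (hUopen : IsOpen U) (hUconn : IsConnected U)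
    (hNU : ((-(N1 : ℂ)), (-(N2 : ℂ))) ∈ U) (hZ : DifferentiableOn ℂ Z U)
    (hV : ∃ V : Set (ℂ × ℂ), V ⊆ U ∧ IsOpen V ∧ V.Nonempty ∧
      ∀ p ∈ V,
        Summable (fun m : ℕ × ℕ => (-1 : ℂ) ^ (m.1 + 1) *
          ((1 + ((m.2 : ℝ) + 1) +
              ((m.1 : ℝ) + 1) ^ q * ((m.2 : ℝ) + 1) ^ 2 : ℝ) : ℂ) ^ (-p.2)) ∧
        Z p = ∑' m : ℕ × ℕ, (-1 : ℂ) ^ (m.1 + 1) *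
          ((1 + ((m.2 : ℝ) + 1) +
              ((m.1 : ℝ) + 1) ^ q * ((m.2 : ℝ) + 1) ^ 2 : ℝ) : ℂ) ^ (-p.2)) :
    (∃ σ : ℝ, ∀ s2 : ℂ, σ < s2.re →
      Summable (fun m : ℕ × ℕ => (-1 : ℂ) ^ (m.1 + 1) *
        ((1 + ((m.2 : ℝ) + 1) +
            ((m.1 : ℝ) + 1) ^ q * ((m.2 : ℝ) + 1) ^ 2 : ℝ) : ℂ) ^ (-s2))) ∧
    Transcendental ℚ (Z (-(N1 : ℂ), -(N2 : ℂ))) := by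
  have hq2 : 2 ≤ q := by
    obtain ⟨r, rfl⟩ := hqe
    omega
  refine ⟨⟨1 / 2, fun s hs => summable_seriesTerm hqe hq2 hs⟩, ?_⟩
  obtain ⟨G, hGd, hGs, hGt⟩ := exists_differentiable_cos_mul_tsum hqe hq2
  obtain ⟨V, hVU, hVo, ⟨p, hp⟩, hVs⟩ := hV
  have hcos : Differentiable ℂ fun p : ℂ × ℂ => Complex.cos (Real.pi * p.2) :=
    Complex.differentiable_cos.comp (by fun_prop)
  have hd : DifferentiableOn ℂ (fun p : ℂ × ℂ => Complex.cos (Real.pi * p.2) * Z p - G p.2) U :=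
    (hcos.differentiableOn.mul hZ).sub (hGd.comp differentiable_snd).differentiableOn
  have heq := hd.eqOn_zero_of_preconnected_of_eventuallyEq hUopen hUconn.isPreconnected (hVU hp)
    (by
      filter_upwards [hVo.mem_nhds hp] with x hx
      obtain ⟨h1, h2⟩ := hVs x hx
      rw [hGs x.2 (half_lt_re_of_summable_seriesTerm h1), h2]
      exact sub_self _)
  have h := sub_eq_zero.1 (heq hNU)
  have hc : Complex.cos (Real.pi * -(N2 : ℂ)) = (-1 : ℂ) ^ N2 := by
    rw [mul_neg, Complex.cos_neg, mul_comm]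
    exact_mod_cast congrArg Complex.ofReal (Real.cos_nat_mul_pi N2)
  intro ha
  refine hGt N2 ?_
  rw [← h, hc]
  exact ((isAlgebraic_one.neg).pow N2).mul ha
end
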